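/- arXiv:math/0507163 — 3 statements merged into one kernel-verified Lean document; each statement's English description precedes it below -/
import Mathlib

section
/- Let Γ be a connected simple graph on the vertex set [n] with edge set E, and let Z_Γ := Σ_{{i,j} ∈ E} ConvexHull{e_i, e_j} be its graphical zonotope (Minkowski sum of the segments [e_i, e_j] over all edges). Then Vol Z_Γ equals the number of spanning trees of Γ, i.e., the number of subsets T ⊆ E such that the graph ([n], T) is connected and acyclic; and the number of integer lattice points of Z_Γ (points of Z_Γ ∩ ℤ^n) equals the number of forests in Γ, i.e., the number of subsets F ⊆ E such that the graph ([n], F) is acyclic. -/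
open MeasureTheory Pointwise

/-- The `i`-th standard basis vector of `ℝ^n`. -/
def stdVec (n : ℕ) (i : Fin n) : Fin n → ℝ := fun j => if j = i then 1 else 0

/-- Volume via projection forgetting the last coordinate. -/
noncomputable def projVol (n : ℕ) (P : Set (Fin (n + 1) → ℝ)) : ℝ :=
  (volume ((fun t : Fin (n + 1) → ℝ => fun i : Fin n => t i.castSucc) '' P)).toReal

/-- The segment joining `e_i` and `e_j` for an unordered pair `{i, j}`. -/
def edgeSegment (n : ℕ) : Sym2 (Fin n) → Set (Fin n → ℝ) :=
  Sym2.lift ⟨fun a b => segment ℝ (stdVec n a) (stdVec n b),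
    fun a b => segment_symm ℝ (stdVec n a) (stdVec n b)⟩

/-- The zonotope `∑ [0, u e]` over `e ∈ s`. -/
def zonotope {ι E : Type*} [AddCommGroup E] [Module ℝ E] (u : ι → E) (s : Finset ι) : Set E :=
  ∑ e ∈ s, segment ℝ 0 (u e)

section Zonotope

variable {ι E F : Type*} [AddCommGroup E] [Module ℝ E] [AddCommGroup F] [Module ℝ F]

lemma mem_segment_zero_iff {w x : E} :
    x ∈ segment ℝ 0 w ↔ ∃ r : ℝ, 0 ≤ r ∧ r ≤ 1 ∧ r • w = x := by
  rw [segment_eq_image']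
  simp [and_assoc]

lemma mem_add_segment_iff {A : Set E} {w x : E} :
    x ∈ A + segment ℝ 0 w ↔ ∃ r : ℝ, 0 ≤ r ∧ r ≤ 1 ∧ x - r • w ∈ A := by
  simp only [Set.mem_add, mem_segment_zero_iff]
  constructor
  · rintro ⟨y, hy, _, ⟨r, h0, h1, rfl⟩, rfl⟩
    exact ⟨r, h0, h1, by simpa using hy⟩
  · rintro ⟨r, h0, h1, h⟩
    exact ⟨_, h, _, ⟨r, h0, h1, rfl⟩, by simp⟩

lemma zonotope_empty (u : ι → E) : zonotope u ∅ = {0} := by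
  simp [zonotope, Set.singleton_zero]

lemma zonotope_insert [DecidableEq ι] (u : ι → E) {s : Finset ι} {e : ι} (he : e ∉ s) :
    zonotope u (insert e s) = zonotope u s + segment ℝ 0 (u e) := by
  rw [zonotope, Finset.sum_insert he, add_comm]; rfl

lemma image_zonotope (f : E →ₗ[ℝ] F) (u : ι → E) (s : Finset ι) :
    f '' zonotope u s = zonotope (f ∘ u) s := by
  classical
  simp only [zonotope, Set.image_finsetSum]
  refine Finset.sum_congr rfl fun e _ => ?_
  simpa using image_segment ℝ f.toAffineMap 0 (u e)

lemma convex_zonotope (u : ι → E) (s : Finset ι) : Convex ℝ (zonotope u s) :=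
  convex_sum _ fun _ _ => convex_segment _ _

lemma isCompact_zonotope [TopologicalSpace E] [ContinuousAdd E] [ContinuousSMul ℝ E]
    (u : ι → E) (s : Finset ι) : IsCompact (zonotope u s) := by
  classical
  induction s using Finset.induction_on with
  | empty => simp [zonotope_empty]
  | insert e s he ih =>
    rw [zonotope_insert u he, segment_eq_image']
    exact ih.add (isCompact_Icc.image (by fun_prop))

end Zonotope

section Cut

variable {ι V : Type*} [DecidableEq V]

/-- The number of arcs `a e ← b e`, with `e ∈ s`, whose head is in `U` and whose tail is not. -/
def cutSize (a b : ι → V) (s : Finset ι) (U : Finset V) : ℕ :=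
  (s.filter fun e => a e ∈ U ∧ b e ∉ U).card

lemma cutSize_insert [DecidableEq ι] (a b : ι → V) {s : Finset ι} {e : ι} (he : e ∉ s)
    (U : Finset V) :
    cutSize a b (insert e s) U = cutSize a b s U + if a e ∈ U ∧ b e ∉ U then 1 else 0 := by
  unfold cutSize
  rw [Finset.filter_insert]
  split_ifs <;> simp [he]

lemma cutSize_submodular (a b : ι → V) (s : Finset ι) (U W : Finset V) :
    cutSize a b s (U ∪ W) + cutSize a b s (U ∩ W) ≤ cutSize a b s U + cutSize a b s W := by
  simp only [cutSize, Finset.card_filter, ← Finset.sum_add_distrib]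
  refine Finset.sum_le_sum fun e _ => ?_
  simp only [Finset.mem_union, Finset.mem_inter]
  by_cases h1 : a e ∈ U <;> by_cases h2 : a e ∈ W <;> by_cases h3 : b e ∈ U <;>
    by_cases h4 : b e ∈ W <;> simp [h1, h2, h3, h4]

lemma sum_edge (p q : V) (U : Finset V) (r : ℝ) :
    ∑ v ∈ U, (r • (Pi.single p 1 - Pi.single q 1 : V → ℝ)) v =
      r * ((if p ∈ U then 1 else 0) - if q ∈ U then 1 else 0) := by
  simp [← Finset.mul_sum, Finset.sum_sub_distrib, Pi.single_apply]

/-- The feasibility theorem for flows with prescribed divergence. -/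
lemma mem_zonotope_iff_cut [Fintype V] (a b : ι → V) (s : Finset ι) (x : V → ℝ) :
    x ∈ zonotope (fun e => (Pi.single (a e) 1 - Pi.single (b e) 1 : V → ℝ)) s ↔
      ∑ v, x v = 0 ∧ ∀ U : Finset V, ∑ v ∈ U, x v ≤ cutSize a b s U := by
  classical
  induction s using Finset.induction_on generalizing x with
  | empty =>
    simp only [zonotope_empty, Set.mem_singleton_iff, cutSize]
    constructor
    · rintro rfl; simp
    · rintro ⟨h0, h⟩
      have hle : ∀ v, x v ≤ 0 := fun v => by simpa using h {v}
      funext v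
      exact (Finset.sum_eq_zero_iff_of_nonpos fun v _ => hle v).1 h0 v (Finset.mem_univ v)
  | insert e s he ih =>
    rw [zonotope_insert _ he, mem_add_segment_iff]
    simp only [ih, cutSize_insert a b he, Pi.sub_apply x, Finset.sum_sub_distrib, sum_edge]
    constructor
    · rintro ⟨r, h0, h1, hs, hU⟩
      refine ⟨by simpa using hs, fun U => ?_⟩
      have := hU U
      push_cast
      by_cases h1 : a e ∈ U <;> by_cases h2 : b e ∈ U <;> simp [h1, h2] at this ⊢ <;> linarith
    · rintro ⟨hs, hU⟩
      let lower : Finset ℝ := insert 0 ((Finset.univ.filter fun U : Finset V =>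
        a e ∈ U ∧ b e ∉ U).image fun U => ∑ v ∈ U, x v - cutSize a b s U)
      have hne : lower.Nonempty := Finset.insert_nonempty _ _
      have hlow : ∀ U : Finset V, a e ∈ U → b e ∉ U →
          ∑ v ∈ U, x v - cutSize a b s U ≤ lower.max' hne := fun U h1 h2 =>
        Finset.le_max' _ _ <| Finset.mem_insert_of_mem <| Finset.mem_image_of_mem
          (fun U => ∑ v ∈ U, x v - cutSize a b s U) (by simp [h1, h2])
      have hmax : ∀ c : ℝ, 0 ≤ c → (∀ U : Finset V, a e ∈ U → b e ∉ U →
          ∑ v ∈ U, x v - cutSize a b s U ≤ c) → lower.max' hne ≤ c := by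
        intro c hc h
        refine Finset.max'_le _ _ _ fun y hy => ?_
        simp only [lower, Finset.mem_insert, Finset.mem_image, Finset.mem_filter,
          Finset.mem_univ, true_and] at hy
        rcases hy with rfl | ⟨U, ⟨h1, h2⟩, rfl⟩
        exacts [hc, h U h1 h2]
      refine ⟨lower.max' hne, Finset.le_max' _ _ (Finset.mem_insert_self _ _),
        hmax 1 zero_le_one fun U h1 h2 => ?_, by simpa using hs, fun U => ?_⟩
      · have := hU U
        simp [h1, h2] at this
        linarith
      · by_cases h1 : a e ∈ U <;> by_cases h2 : b e ∈ U
        · simpa [h1, h2] using hU U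
        · have := hlow U h1 h2
          simp [h1, h2]
          linarith
        · have hUU := hU U
          simp only [h1, false_and, if_false, add_zero] at hUU
          have := hmax (cutSize a b s U - ∑ v ∈ U, x v) (by linarith) fun W h3 h4 => by
            have e1 := hU (U ∪ W)
            have e2 := hU (U ∩ W)
            simp only [Finset.mem_union, Finset.mem_inter, h1, h2, h3, h4, true_or,
              not_true, and_false, if_false, add_zero, false_and] at e1 e2
            have e3 : (cutSize a b s (U ∪ W) + cutSize a b s (U ∩ W) : ℝ) ≤
              cutSize a b s U + cutSize a b s W := mod_cast cutSize_submodular a b s U W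
            have e4 := Finset.sum_union_inter (s₁ := U) (s₂ := W) (f := x)
            linarith
          simp [h1, h2]
          linarith
        · simpa [h1, h2] using hU U

lemma add_ceil_smul_edge_mem [Fintype V] (a b : ι → V) (s : Finset ι) (z : V → ℤ) (t : ℝ)
    (p q : V)
    (h : (fun v => (z v : ℝ)) + t • (Pi.single p 1 - Pi.single q 1 : V → ℝ) ∈
      zonotope (fun e => (Pi.single (a e) 1 - Pi.single (b e) 1 : V → ℝ)) s) :
    (fun v => (z v : ℝ)) + (⌈t⌉ : ℝ) • (Pi.single p 1 - Pi.single q 1 : V → ℝ) ∈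
      zonotope (fun e => (Pi.single (a e) 1 - Pi.single (b e) 1 : V → ℝ)) s := by
  rw [mem_zonotope_iff_cut] at h ⊢
  simp only [Pi.add_apply (fun v => (z v : ℝ)), Finset.sum_add_distrib, sum_edge] at h ⊢
  refine ⟨by simpa using h.1, fun U => ?_⟩
  have hU := h.2 U
  have hc := Int.le_ceil t
  by_cases h1 : p ∈ U <;> by_cases h2 : q ∈ U <;> simp only [h1, h2, if_true, if_false] at hU ⊢
  · simpa using hU
  · have : ⌈t⌉ ≤ (cutSize a b s U : ℤ) - ∑ v ∈ U, z v := by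
      rw [Int.ceil_le]; push_cast; linarith
    have : (⌈t⌉ : ℝ) ≤ (cutSize a b s U : ℝ) - ∑ v ∈ U, (z v : ℝ) := mod_cast this
    linarith
  · linarith
  · simpa using hU

end Cut

/-- The image of a vertex in reduced coordinates: the root becomes `0`. -/
def IsVertexVec {n : ℕ} (x : Fin n → ℝ) : Prop := x = 0 ∨ ∃ i, x = Pi.single i 1

/-- A difference of two vertices in reduced coordinates. -/
def IsEdgeVec {n : ℕ} (x : Fin n → ℝ) : Prop :=
  ∃ p q, IsVertexVec p ∧ IsVertexVec q ∧ x = p - q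

lemma IsVertexVec.exists_lift {n : ℕ} {x : Fin n → ℝ} (h : IsVertexVec x) :
    ∃ o : Option (Fin n), LinearMap.funLeft ℝ ℝ some (Pi.single o 1 : Option (Fin n) → ℝ) = x := by
  rcases h with rfl | ⟨i, rfl⟩
  · exact ⟨none, by ext j; simp [LinearMap.funLeft_apply]⟩
  · exact ⟨some i, by ext j; simp [LinearMap.funLeft_apply, Pi.single_apply]⟩

lemma IsEdgeVec.neg {n : ℕ} {x : Fin n → ℝ} (h : IsEdgeVec x) : IsEdgeVec (-x) := by
  obtain ⟨p, q, hp, hq, rfl⟩ := h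
  exact ⟨q, p, hq, hp, by simp⟩

lemma add_ceil_smul_mem {ι : Type*} {n : ℕ} {u : ι → Fin n → ℝ} {s : Finset ι}
    (hu : ∀ e ∈ s, IsEdgeVec (u e)) {w : Fin n → ℝ} (hw : IsEdgeVec w) (z : Fin n → ℤ) (t : ℝ)
    (h : (fun i => (z i : ℝ)) + t • w ∈ zonotope u s) :
    (fun i => (z i : ℝ)) + (⌈t⌉ : ℝ) • w ∈ zonotope u s := by
  classical
  have key : ∀ x : Fin n → ℝ, IsEdgeVec x → ∃ p q : Option (Fin n), LinearMap.funLeft ℝ ℝ some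
      (Pi.single p 1 - Pi.single q 1 : Option (Fin n) → ℝ) = x := by
    rintro _ ⟨_, _, hp, hq, rfl⟩
    obtain ⟨p, rfl⟩ := hp.exists_lift
    obtain ⟨q, rfl⟩ := hq.exists_lift
    exact ⟨p, q, by rw [map_sub]⟩
  have key' : ∀ e : ι, ∃ p q : Option (Fin n), e ∈ s → LinearMap.funLeft ℝ ℝ some
      (Pi.single p 1 - Pi.single q 1 : Option (Fin n) → ℝ) = u e := by
    intro e
    by_cases he : e ∈ s
    · obtain ⟨p, q, h⟩ := key _ (hu e he)
      exact ⟨p, q, fun _ => h⟩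
    · exact ⟨none, none, fun h => absurd h he⟩
  choose a b hab using key'
  obtain ⟨p, q, rfl⟩ := key w hw
  have hZ : zonotope u s = LinearMap.funLeft ℝ ℝ some ''
      zonotope (fun e => (Pi.single (a e) 1 - Pi.single (b e) 1 : Option (Fin n) → ℝ)) s := by
    rw [image_zonotope]
    exact Finset.sum_congr rfl fun e he => by simp [hab e he]
  rw [hZ] at h ⊢
  obtain ⟨y, hy, hyx⟩ := h
  let z' : Option (Fin n) → ℤ := fun o => o.elim (-∑ i, z i) z
  have hz' : LinearMap.funLeft ℝ ℝ some (fun o => (z' o : ℝ)) = fun i => (z i : ℝ) := rfl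
  refine ⟨_, add_ceil_smul_edge_mem a b s z' t p q ?_, by rw [map_add, map_smul, hz']⟩
  convert hy using 1
  rw [← hz', ← map_smul, ← map_add] at hyx
  have hsome : ∀ i, y (some i) = ((fun v => (z' v : ℝ)) +
      t • (Pi.single p 1 - Pi.single q 1 : Option (Fin n) → ℝ)) (some i) :=
    fun i => congrFun hyx i
  have hy0 := ((mem_zonotope_iff_cut a b s y).1 hy).1
  have hx0 : ∑ o, ((fun v => (z' v : ℝ)) +
      t • (Pi.single p 1 - Pi.single q 1 : Option (Fin n) → ℝ)) o = 0 := by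
    simp only [Pi.add_apply (fun v => (z' v : ℝ)), Finset.sum_add_distrib, sum_edge]
    simp [z', Fintype.sum_option]
  rw [Fintype.sum_option] at hy0 hx0
  simp only [← hsome] at hx0
  funext o
  cases o with
  | none => linarith
  | some i => exact (hsome i).symm

/-- The linear map along `w` onto the coordinates other than `a`, assuming `w a = 1`. -/
def collapse {m : ℕ} (a : Fin (m + 1)) (w : Fin (m + 1) → ℝ) :
    (Fin (m + 1) → ℝ) →ₗ[ℝ] (Fin m → ℝ) where
  toFun x j := x (a.succAbove j) - x a * w (a.succAbove j)
  map_add' x y := by ext j; simp; ring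
  map_smul' c x := by ext j; simp; ring

section Collapse

variable {m : ℕ} {a : Fin (m + 1)} {w : Fin (m + 1) → ℝ}

lemma collapse_apply (x : Fin (m + 1) → ℝ) (j : Fin m) :
    collapse a w x j = x (a.succAbove j) - x a * w (a.succAbove j) := rfl

lemma collapse_insertNth_add (ha : w a = 1) (y : Fin m → ℝ) (t : ℝ) :
    collapse a w (a.insertNth 0 y + t • w : Fin (m + 1) → ℝ) = y := by
  ext j; simp [collapse_apply, ha]

lemma insertNth_collapse_add (ha : w a = 1) (x : Fin (m + 1) → ℝ) :
    (a.insertNth 0 (collapse a w x) + x a • w : Fin (m + 1) → ℝ) = x := by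
  ext j
  cases j using a.succAboveCases <;> simp [collapse_apply, ha]

lemma ker_collapse (ha : w a = 1) : LinearMap.ker (collapse a w) = Submodule.span ℝ {w} := by
  ext x
  rw [LinearMap.mem_ker, Submodule.mem_span_singleton]
  constructor
  · intro h
    refine ⟨x a, ?_⟩
    have := insertNth_collapse_add ha x
    rw [h] at this
    have h0 : (a.insertNth 0 (0 : Fin m → ℝ) : Fin (m + 1) → ℝ) = 0 := by
      ext j; cases j using a.succAboveCases <;> simp
    rwa [h0, zero_add] at this
  · rintro ⟨c, rfl⟩
    ext j; simp [collapse_apply, ha]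

lemma mem_image_collapse_iff (ha : w a = 1) {A : Set (Fin (m + 1) → ℝ)} {y : Fin m → ℝ} :
    y ∈ collapse a w '' A ↔ ∃ t : ℝ, (a.insertNth 0 y + t • w : Fin (m + 1) → ℝ) ∈ A := by
  constructor
  · rintro ⟨x, hx, rfl⟩
    exact ⟨x a, by rwa [insertNth_collapse_add ha]⟩
  · rintro ⟨t, ht⟩
    exact ⟨_, ht, collapse_insertNth_add ha y t⟩

lemma volume_eq_lintegral_fiber (ha : w a = 1) {A : Set (Fin (m + 1) → ℝ)}
    (hA : MeasurableSet A) :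
    volume A = ∫⁻ y : Fin m → ℝ,
      volume {t : ℝ | (a.insertNth 0 y + t • w : Fin (m + 1) → ℝ) ∈ A} := by
  let w' : Fin m → ℝ := fun j => w (a.succAbove j)
  have hshear : MeasurePreserving (fun p : ℝ × (Fin m → ℝ) => (p.1, p.2 + p.1 • w'))
      (volume.prod volume) (volume.prod volume) := by
    refine (MeasurePreserving.id volume).skew_product (g := fun t y => y + t • w') ?_ ?_
    · fun_prop
    · exact Filter.Eventually.of_forall fun t =>
        (measurePreserving_add_right volume (t • w')).map_eq
  have hpres := (volume_preserving_piFinSuccAbove (fun _ : Fin (m + 1) => ℝ) a).symm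
  have hcomp := hpres.comp hshear
  rw [← hcomp.measure_preimage hA.nullMeasurableSet,
    Measure.prod_apply_symm (hcomp.measurable hA)]
  refine lintegral_congr fun y => congrArg _ ?_
  ext t
  have : (a.insertNth t (y + t • w') : Fin (m + 1) → ℝ) = a.insertNth 0 y + t • w := by
    ext j; cases j using a.succAboveCases <;> simp [ha, w']
  simp only [Set.mem_preimage, Set.mem_ofPred_eq, ← this]
  rfl

lemma volume_add_segment_of_coord_eq_one (ha : w a = 1) {A : Set (Fin (m + 1) → ℝ)}
    (hc : Convex ℝ A) (hA : IsCompact A) :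
    volume (A + segment ℝ 0 w) = volume A + volume (collapse a w '' A) := by
  have hseg : IsCompact (segment ℝ 0 w) := by
    rw [segment_eq_image']
    exact isCompact_Icc.image (by fun_prop)
  have hcont : Continuous (collapse a w) := (collapse a w).continuous_of_finiteDimensional
  have hB : MeasurableSet (collapse a w '' A) := (hA.image hcont).measurableSet
  rw [volume_eq_lintegral_fiber ha (hA.add hseg).measurableSet,
    volume_eq_lintegral_fiber ha hA.measurableSet, ← lintegral_indicator_one hB,
    ← lintegral_add_right _ (measurable_one.indicator hB)]
  refine lintegral_congr fun y => ?_
  let f : ℝ → Fin (m + 1) → ℝ := fun t => a.insertNth 0 y + t • w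
  have hadd : {t : ℝ | f t ∈ A + segment ℝ 0 w} =
      {t : ℝ | ∃ r : ℝ, 0 ≤ r ∧ r ≤ 1 ∧ f (t - r) ∈ A} := by
    ext t
    simp only [Set.mem_ofPred_eq, mem_add_segment_iff, f, sub_smul, add_sub_assoc]
  by_cases hy : y ∈ collapse a w '' A
  · have hne : {t : ℝ | f t ∈ A}.Nonempty := (mem_image_collapse_iff ha).1 hy
    have hcl : IsClosed {t : ℝ | f t ∈ A} := hA.isClosed.preimage (by fun_prop)
    have hcpt : IsCompact {t : ℝ | f t ∈ A} := by
      refine (hA.image (continuous_apply a)).of_isClosed_subset hcl fun t ht => ⟨_, ht, ?_⟩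
      simp [f, ha]
    have hconv : Convex ℝ {t : ℝ | f t ∈ A} := by
      intro t ht t' ht' c c' h0 h0' h1
      have := hc ht ht' h0 h0' h1
      simp only [Set.mem_ofPred_eq]
      convert this using 1
      simp only [f]
      nth_rw 1 [← one_smul ℝ (a.insertNth 0 y : Fin (m + 1) → ℝ), ← h1]
      simp only [smul_eq_mul]
      module
    obtain ⟨p, q, hpq⟩ : ∃ p q, {t : ℝ | f t ∈ A} = Set.Icc p q :=
      ⟨_, _, eq_Icc_of_connected_compact ⟨hne, hconv.isPreconnected⟩ hcpt⟩
    have hle : p ≤ q := by rw [hpq] at hne; exact Set.nonempty_Icc.1 hne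
    have hmem : ∀ t, f t ∈ A ↔ p ≤ t ∧ t ≤ q := fun t => Set.ext_iff.1 hpq t
    have hadd' : {t : ℝ | f t ∈ A + segment ℝ 0 w} = Set.Icc p (q + 1) := by
      rw [hadd]
      ext t
      simp only [Set.mem_ofPred_eq, hmem, Set.mem_Icc]
      constructor
      · rintro ⟨r, h0, h1, h2, h3⟩
        constructor <;> linarith
      · rintro ⟨h1, h2⟩
        rcases le_total t q with h | h
        · exact ⟨0, le_rfl, zero_le_one, by linarith, by linarith⟩
        · exact ⟨t - q, by linarith, by linarith, by linarith, by linarith⟩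
    change volume {t : ℝ | f t ∈ A + segment ℝ 0 w} = volume {t : ℝ | f t ∈ A} + _
    rw [hadd', hpq, Real.volume_Icc, Real.volume_Icc, Set.indicator_of_mem hy, Pi.one_apply,
      ← ENNReal.ofReal_one, ← ENNReal.ofReal_add (by linarith) zero_le_one]
    congr 1; ring
  · have hno : ∀ t, f t ∉ A := fun t ht => hy ((mem_image_collapse_iff ha).2 ⟨t, ht⟩)
    change volume {t : ℝ | f t ∈ A + segment ℝ 0 w} = volume {t : ℝ | f t ∈ A} + _
    rw [hadd, Set.indicator_of_notMem hy]
    simp [hno]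

end Collapse

lemma IsVertexVec.exists_int {n : ℕ} {x : Fin n → ℝ} (h : IsVertexVec x) :
    ∃ z : Fin n → ℤ, x = fun i => (z i : ℝ) := by
  rcases h with rfl | ⟨i, rfl⟩
  · exact ⟨0, by ext; simp⟩
  · exact ⟨Pi.single i 1, by ext j; simp [Pi.single_apply]⟩

lemma IsEdgeVec.exists_int {n : ℕ} {x : Fin n → ℝ} (h : IsEdgeVec x) :
    ∃ z : Fin n → ℤ, x = fun i => (z i : ℝ) := by
  obtain ⟨_, _, hp, hq, rfl⟩ := h
  obtain ⟨p, rfl⟩ := hp.exists_int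
  obtain ⟨q, rfl⟩ := hq.exists_int
  exact ⟨p - q, by ext; simp⟩

lemma IsVertexVec.apply_eq {n : ℕ} {x : Fin n → ℝ} (h : IsVertexVec x) (i : Fin n) :
    x i = 0 ∨ x = Pi.single i 1 := by
  rcases h with rfl | ⟨j, rfl⟩
  · simp
  · by_cases hij : i = j
    · subst hij; simp
    · simp [hij]

/-- A nonzero edge vector, up to sign, has a coordinate equal to `1`. -/
lemma IsEdgeVec.exists_coord {n : ℕ} {x : Fin n → ℝ} (h : IsEdgeVec x) (h0 : x ≠ 0) :
    ∃ a, x a = 1 ∨ (-x) a = 1 := by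
  obtain ⟨p, q, hp, hq, rfl⟩ := h
  obtain ⟨a, ha⟩ := Function.ne_iff.1 h0
  refine ⟨a, ?_⟩
  rcases hp.apply_eq a with h1 | h1 <;> rcases hq.apply_eq a with h2 | h2 <;>
    simp_all

lemma IsVertexVec.comp_succAbove {m : ℕ} {x : Fin (m + 1) → ℝ} (h : IsVertexVec x)
    (a : Fin (m + 1)) : IsVertexVec fun j => x (a.succAbove j) := by
  rcases h with rfl | ⟨i, rfl⟩
  · exact .inl rfl
  · cases i using a.succAboveCases with
    | x => exact .inl (by ext j; simp)
    | p i => exact .inr ⟨i, by ext j; simp [Pi.single_apply]⟩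

lemma IsVertexVec.map_collapse {m : ℕ} {a : Fin (m + 1)} {w x : Fin (m + 1) → ℝ}
    (hw : IsEdgeVec w) (ha : w a = 1) (hx : IsVertexVec x) : IsVertexVec (collapse a w x) := by
  rcases hx.apply_eq a with h | rfl
  · convert hx.comp_succAbove a using 1
    ext j; simp [collapse_apply, h]
  · obtain ⟨p, q, hp, hq, rfl⟩ := hw
    convert hq.comp_succAbove a using 1
    ext j
    rcases hp.apply_eq a with h1 | rfl
    · rcases hq.apply_eq a with h2 | rfl
      · simp [h1, h2] at ha
      · simp [h1] at ha
        norm_num at ha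
    · simp [collapse_apply]

lemma IsEdgeVec.map_collapse {m : ℕ} {a : Fin (m + 1)} {w x : Fin (m + 1) → ℝ}
    (hw : IsEdgeVec w) (ha : w a = 1) (hx : IsEdgeVec x) : IsEdgeVec (collapse a w x) := by
  obtain ⟨p, q, hp, hq, rfl⟩ := hx
  exact ⟨_, _, hp.map_collapse hw ha, hq.map_collapse hw ha, map_sub _ _ _⟩

/-- The points of `ℤ^n` lying in `A`. -/
def latticePoints {n : ℕ} (A : Set (Fin n → ℝ)) : Set (Fin n → ℤ) :=
  {z | (fun i => (z i : ℝ)) ∈ A}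

lemma finite_latticePoints {n : ℕ} {A : Set (Fin n → ℝ)} (hA : IsCompact A) :
    (latticePoints A).Finite := by
  obtain ⟨R, hR⟩ := hA.isBounded.exists_norm_le
  refine (Set.finite_Icc (fun _ : Fin n => -⌈R⌉) fun _ => ⌈R⌉).subset fun z hz => ?_
  have h : ∀ i, |(z i : ℝ)| ≤ ⌈R⌉ := fun i =>
    ((norm_le_pi_norm (fun i => (z i : ℝ)) i).trans (hR _ hz)).trans (Int.le_ceil R)
  exact ⟨fun i => mod_cast (abs_le.1 (h i)).1, fun i => mod_cast (abs_le.1 (h i)).2⟩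

lemma ncard_latticePoints_add_segment_of_coord_eq_one {m : ℕ} {a : Fin (m + 1)}
    {w : Fin (m + 1) → ℝ} (hw : IsEdgeVec w) (ha : w a = 1) {A : Set (Fin (m + 1) → ℝ)}
    (hc : Convex ℝ A) (hA : IsCompact A)
    (hint : ∀ (z : Fin (m + 1) → ℤ) (t : ℝ), (fun i => (z i : ℝ)) + t • w ∈ A →
      (fun i => (z i : ℝ)) + (⌈t⌉ : ℝ) • w ∈ A ∧ (fun i => (z i : ℝ)) + (⌊t⌋ : ℝ) • w ∈ A) :
    (latticePoints (A + segment ℝ 0 w)).ncard =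
      (latticePoints A).ncard + (latticePoints (collapse a w '' A)).ncard := by
  obtain ⟨v, hv⟩ := hw.exists_int
  have hva : v a = 1 := by
    rw [hv] at ha
    exact Int.cast_eq_one.1 ha
  have hseg : IsCompact (segment ℝ 0 w) := by
    rw [segment_eq_image']
    exact isCompact_Icc.image (by fun_prop)
  have hsub : latticePoints A ⊆ latticePoints (A + segment ℝ 0 w) := fun z hz =>
    mem_add_segment_iff.2 ⟨0, le_rfl, zero_le_one, by rwa [zero_smul, sub_zero]⟩
  rw [← Set.ncard_sdiff_add_ncard_of_subset hsub (finite_latticePoints (hA.add hseg)), add_comm]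
  congr 1
  have hdiff : ∀ z : Fin (m + 1) → ℤ, z ∈ latticePoints (A + segment ℝ 0 w) \ latticePoints A ↔
      (fun i => (z i : ℝ)) - w ∈ A ∧ (fun i => (z i : ℝ)) ∉ A := by
    intro z
    refine and_congr_left fun hz => ⟨fun h => ?_, fun h => ?_⟩
    · obtain ⟨r, h0, h1, h⟩ := mem_add_segment_iff.1 h
      have hr : r ≠ 0 := by rintro rfl; exact hz (by rwa [zero_smul, sub_zero] at h)
      have hfl : ⌊-r⌋ = -1 := by
        rw [Int.floor_eq_iff]
        push_cast
        exact ⟨by linarith, by linarith [lt_of_le_of_ne h0 hr.symm]⟩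
      have := (hint z (-r) (by rwa [neg_smul, ← sub_eq_add_neg])).2
      simpa [hfl, ← sub_eq_add_neg] using this
    · exact mem_add_segment_iff.2 ⟨1, zero_le_one, le_rfl, by simpa using h⟩
  refine Set.ncard_congr (fun z _ => fun j => z (a.succAbove j) - z a * v (a.succAbove j))
    ?_ ?_ ?_
  · intro z hz
    refine ⟨_, ((hdiff z).1 hz).1, ?_⟩
    ext j
    simp [collapse_apply, hv, hva]
    ring
  · have hlt : ∀ z z' : Fin (m + 1) → ℤ, (fun i => (z i : ℝ)) ∉ A →
        (fun i => (z i : ℝ)) - w ∈ A → (fun i => (z' i : ℝ)) - w ∈ A →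
        (∀ j, z (a.succAbove j) - z a * v (a.succAbove j) =
          z' (a.succAbove j) - z' a * v (a.succAbove j)) → z' a ≤ z a := by
      intro z z' hz hzw hzw' heq
      by_contra! hlt
      apply hz
      have hk : (1 : ℝ) ≤ z' a - z a := by
        have : (1 : ℤ) ≤ z' a - z a := by omega
        exact_mod_cast this
      set k : ℝ := z' a - z a with hkdef
      have hz' : (fun i => (z' i : ℝ)) = (fun i => (z i : ℝ)) + k • w := by
        ext i
        cases i using a.succAboveCases with
        | x => simp [ha, hkdef]
        | p j =>
          have h : ((z (a.succAbove j) : ℝ) - z a * v (a.succAbove j)) =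
            z' (a.succAbove j) - z' a * v (a.succAbove j) := mod_cast heq j
          simp [hv, hkdef]
          linarith
      rw [hz'] at hzw'
      have hk0 : k ≠ 0 := by linarith
      have := hc hzw hzw' (a := (k - 1) / k) (b := 1 / k)
        (div_nonneg (by linarith) (by linarith)) (by positivity) (by field_simp; ring)
      convert this using 1
      ext i
      simp
      field_simp
      ring
    intro z z' hz hz' heq
    have hz := (hdiff z).1 hz
    have hz' := (hdiff z').1 hz'
    have haa : z a = z' a := le_antisymm
      (hlt z' z hz'.2 hz'.1 hz.1 fun j => (congrFun heq j).symm)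
      (hlt z z' hz.2 hz.1 hz'.1 fun j => congrFun heq j)
    ext i
    cases i using a.succAboveCases with
    | x => exact haa
    | p j => simpa [haa] using congrFun heq j
  · intro y hy
    let z : ℤ → Fin (m + 1) → ℤ := fun k => a.insertNth 0 y + k • v
    have hz : ∀ k, (fun i => (z k i : ℝ)) =
        (a.insertNth 0 (fun j => (y j : ℝ)) + (k : ℝ) • w : Fin (m + 1) → ℝ) := by
      intro k
      ext i
      cases i using a.succAboveCases <;> simp [z, hv]
    have hz0 : (fun i => (z 0 i : ℝ)) = (a.insertNth 0 (fun j => (y j : ℝ)) : _ → ℝ) := by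
      simp [hz]
    obtain ⟨t, ht⟩ := (mem_image_collapse_iff ha).1 hy
    rw [← hz0] at ht
    have hne : ∃ k : ℤ, (fun i => (z k i : ℝ)) ∈ A := ⟨⌈t⌉, by
      rw [hz, ← hz0]; exact (hint _ _ ht).1⟩
    obtain ⟨R, hR⟩ := hA.isBounded.exists_norm_le
    have hbdd : ∃ b : ℤ, ∀ k : ℤ, (fun i => (z k i : ℝ)) ∈ A → k ≤ b := by
      refine ⟨⌈R⌉, fun k hk => ?_⟩
      have h1 := (norm_le_pi_norm _ a).trans (hR _ hk)
      have h2 : z k a = k := by simp [z, hva]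
      rw [h2, Real.norm_eq_abs] at h1
      exact_mod_cast (le_abs_self _).trans (h1.trans (Int.le_ceil R))
    obtain ⟨k, hk, hmax⟩ := Int.exists_greatest_of_bdd hbdd hne
    refine ⟨z (k + 1), (hdiff _).2 ⟨?_, fun h => ?_⟩, ?_⟩
    · convert hk using 1
      rw [hz, hz]
      push_cast
      module
    · have := hmax _ h
      omega
    · ext j
      simp [z, hva]

section Translate

variable {n : ℕ} (A : Set (Fin n → ℝ))

lemma ncard_latticePoints_translate (v : Fin n → ℤ) :
    (latticePoints ((fun x => (fun i => (v i : ℝ)) + x) '' A)).ncard =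
      (latticePoints A).ncard := by
  rw [← Set.ncard_image_of_injective (latticePoints A) (add_right_injective v)]
  congr 1
  ext z
  constructor
  · rintro ⟨x, hx, hxz⟩
    refine ⟨z - v, ?_, by simp⟩
    have hzx : (fun i => ((z - v) i : ℝ)) = x := ?_
    · rwa [latticePoints, Set.mem_ofPred_eq, hzx]
    ext i
    have := congrFun hxz i
    simp at this ⊢
    linarith
  · rintro ⟨y, hy, rfl⟩
    exact ⟨_, hy, by ext; simp⟩

lemma add_segment_eq_translate_neg (w : Fin n → ℝ) :
    A + segment ℝ 0 w = (fun x => w + x) '' (A + segment ℝ 0 (-w)) := by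
  ext x
  simp only [Set.mem_image, mem_add_segment_iff]
  constructor
  · rintro ⟨r, h0, h1, h⟩
    refine ⟨x - w, ⟨1 - r, by linarith, by linarith, ?_⟩, by abel⟩
    convert h using 1
    module
  · rintro ⟨y, ⟨r, h0, h1, h⟩, rfl⟩
    refine ⟨1 - r, by linarith, by linarith, ?_⟩
    convert h using 1
    module

end Translate

/-- Adding a segment to a graphical zonotope: the volume and the number of lattice points grow by
those of the projection along the segment. -/
lemma IsEdgeVec.exists_contraction {m : ℕ} {w : Fin (m + 1) → ℝ} (hw : IsEdgeVec w)
    (h0 : w ≠ 0) :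
    ∃ f : (Fin (m + 1) → ℝ) →ₗ[ℝ] (Fin m → ℝ), LinearMap.ker f = Submodule.span ℝ {w} ∧
      (∀ x, IsEdgeVec x → IsEdgeVec (f x)) ∧
      ∀ (ι : Type) (u : ι → Fin (m + 1) → ℝ) (s : Finset ι), (∀ e ∈ s, IsEdgeVec (u e)) →
        volume (zonotope u s + segment ℝ 0 w) =
          volume (zonotope u s) + volume (zonotope (f ∘ u) s) ∧
        (latticePoints (zonotope u s + segment ℝ 0 w)).ncard =
          (latticePoints (zonotope u s)).ncard + (latticePoints (zonotope (f ∘ u) s)).ncard := by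
  obtain ⟨a, ha⟩ := hw.exists_coord h0
  have key : ∀ w : Fin (m + 1) → ℝ, IsEdgeVec w → w a = 1 →
      ∀ (ι : Type) (u : ι → Fin (m + 1) → ℝ) (s : Finset ι), (∀ e ∈ s, IsEdgeVec (u e)) →
        volume (zonotope u s + segment ℝ 0 w) =
          volume (zonotope u s) + volume (zonotope (collapse a w ∘ u) s) ∧
        (latticePoints (zonotope u s + segment ℝ 0 w)).ncard =
          (latticePoints (zonotope u s)).ncard +
            (latticePoints (zonotope (collapse a w ∘ u) s)).ncard := by
    intro w hw ha ι u s hu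
    rw [← image_zonotope]
    refine ⟨volume_add_segment_of_coord_eq_one ha (convex_zonotope u s) (isCompact_zonotope u s),
      ncard_latticePoints_add_segment_of_coord_eq_one hw ha (convex_zonotope u s)
        (isCompact_zonotope u s) fun z t h => ⟨add_ceil_smul_mem hu hw z t h, ?_⟩⟩
    have := add_ceil_smul_mem hu hw.neg z (-t) (by simpa using h)
    simpa [Int.ceil_neg] using this
  rcases ha with ha | ha
  · exact ⟨_, ker_collapse ha, fun x hx => hw.map_collapse ha hx, key w hw ha⟩
  · refine ⟨_, (ker_collapse ha).trans ?_, fun x hx => hw.neg.map_collapse ha hx, ?_⟩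
    · rw [← Set.neg_singleton, Submodule.span_neg]
    · intro ι u s hu
      obtain ⟨v, hv⟩ := hw.exists_int
      rw [add_segment_eq_translate_neg, ← (key (-w) hw.neg ha ι u s hu).1,
        ← (key (-w) hw.neg ha ι u s hu).2]
      refine ⟨by simp, ?_⟩
      nth_rw 1 [hv]
      exact ncard_latticePoints_translate _ v

section Independent

variable {ι E F : Type*} [AddCommGroup E] [Module ℝ E] [AddCommGroup F] [Module ℝ F]

lemma linearIndepOn_insert_iff_contraction (u : ι → E) {e : ι} {t : Set ι} (he : e ∉ t)
    (h0 : u e ≠ 0) (f : E →ₗ[ℝ] F) (hf : LinearMap.ker f = Submodule.span ℝ {u e}) :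
    LinearIndepOn ℝ u (insert e t) ↔ LinearIndepOn ℝ (f ∘ u) t := by
  rw [Set.insert_eq, linearIndepOn_union_iff_quotient (by simpa using he), Set.image_singleton,
    and_iff_right ((linearIndepOn_singleton_iff ℝ).2 h0)]
  rw [← LinearMap.linearIndepOn_iff_of_injOn ((Submodule.span ℝ {u e}).liftQ f hf.ge)
    (LinearMap.ker_eq_bot.1 (Submodule.ker_liftQ_eq_bot _ _ _ hf.le)).injOn]
  rfl

open Classical in
/-- The subsets of `s` on which `u` is linearly independent and whose size satisfies `Q`. -/
noncomputable def independentSets (u : ι → E) (s : Finset ι) (Q : ℕ → Prop) :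
    Finset (Finset ι) :=
  s.powerset.filter fun t => LinearIndepOn ℝ u (t : Set ι) ∧ Q t.card

lemma mem_independentSets {u : ι → E} {s : Finset ι} {Q : ℕ → Prop} {t : Finset ι} :
    t ∈ independentSets u s Q ↔ t ⊆ s ∧ LinearIndepOn ℝ u (t : Set ι) ∧ Q t.card := by
  simp [independentSets]

lemma independentSets_insert_of_eq_zero [DecidableEq ι] (u : ι → E) {s : Finset ι} {e : ι}
    (h0 : u e = 0) (Q : ℕ → Prop) :
    independentSets u (insert e s) Q = independentSets u s Q := by
  ext t
  simp only [mem_independentSets]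
  refine and_congr_left fun h => ⟨fun hs => ?_, fun hs => hs.trans (Finset.subset_insert _ _)⟩
  rwa [Finset.subset_insert_iff_of_notMem] at hs
  exact fun he => h.1.ne_zero he h0

lemma card_independentSets_insert [DecidableEq ι] (u : ι → E) {s : Finset ι} {e : ι}
    (he : e ∉ s) (h0 : u e ≠ 0) (f : E →ₗ[ℝ] F) (hf : LinearMap.ker f = Submodule.span ℝ {u e})
    (Q : ℕ → Prop) :
    (independentSets u (insert e s) Q).card =
      (independentSets u s Q).card + (independentSets (f ∘ u) s fun k => Q (k + 1)).card := by
  have hunion : independentSets u (insert e s) Q = independentSets u s Q ∪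
      (independentSets (f ∘ u) s fun k => Q (k + 1)).image (insert e) := by
    ext t
    simp only [Finset.mem_union, Finset.mem_image, mem_independentSets]
    constructor
    · rintro ⟨hs, hi, hQ⟩
      by_cases het : e ∈ t
      · refine .inr ⟨t.erase e, ⟨Finset.subset_insert_iff.1 hs, ?_, ?_⟩, Finset.insert_erase het⟩
        · rw [← linearIndepOn_insert_iff_contraction u (by simp) h0 f hf, ← Finset.coe_insert,
            Finset.insert_erase het]
          exact hi
        · rwa [Finset.card_erase_add_one het]
      · exact .inl ⟨(Finset.subset_insert_iff_of_notMem het).1 hs, hi, hQ⟩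
    · rintro (⟨hs, hi, hQ⟩ | ⟨t, ⟨hs, hi, hQ⟩, rfl⟩)
      · exact ⟨hs.trans (Finset.subset_insert _ _), hi, hQ⟩
      · have het : e ∉ t := fun h => he (hs h)
        refine ⟨Finset.insert_subset_insert _ hs, ?_, by rwa [Finset.card_insert_of_notMem het]⟩
        rw [Finset.coe_insert, linearIndepOn_insert_iff_contraction u (by simpa using het) h0 f hf]
        exact hi
  rw [hunion, Finset.card_union_of_disjoint, Finset.card_image_of_injOn]
  · intro t ht t' ht' h
    have h1 : e ∉ t := fun h => he ((mem_independentSets.1 ht).1 h)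
    have h2 : e ∉ t' := fun h => he ((mem_independentSets.1 ht').1 h)
    rw [← Finset.erase_insert h1, ← Finset.erase_insert h2]
    exact congrArg (fun t => Finset.erase t e) h
  · rw [Finset.disjoint_left]
    rintro t ht ht'
    obtain ⟨t, -, rfl⟩ := Finset.mem_image.1 ht'
    exact he ((mem_independentSets.1 ht).1 (Finset.mem_insert_self _ _))

end Independent

/-- Volume and lattice point count of a graphical zonotope, in terms of independent sets. -/
theorem volume_and_ncard_latticePoints_zonotope {ι : Type} (s : Finset ι) {n : ℕ}
    (u : ι → Fin n → ℝ) (hu : ∀ e ∈ s, IsEdgeVec (u e)) :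
    volume (zonotope u s) = (independentSets u s (· = n)).card ∧
      (latticePoints (zonotope u s)).ncard = (independentSets u s fun _ => True).card := by
  classical
  induction s using Finset.induction_on generalizing n with
  | empty =>
    have hlat : latticePoints ({0} : Set (Fin n → ℝ)) = {0} := by
      ext z
      simp [latticePoints, funext_iff]
    have hind : ∀ Q : ℕ → Prop, ∀ t, t ∈ independentSets u ∅ Q ↔ t = ∅ ∧ Q 0 := by
      intro Q t
      rw [mem_independentSets, Finset.subset_empty]
      refine and_congr_right ?_
      rintro rfl
      simp
    rw [zonotope_empty, hlat, Set.ncard_singleton]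
    constructor
    · cases n with
      | zero =>
        have : independentSets u ∅ (· = 0) = {∅} := by ext t; simp [hind]
        rw [this]
        have : ({0} : Set (Fin 0 → ℝ)) = Set.univ := 
          Set.eq_univ_of_forall fun x => Subsingleton.elim _ _
        rw [this, volume_pi, Measure.pi_of_empty]
        simp
      | succ m =>
        have : independentSets u ∅ (· = m + 1) = ∅ := by ext t; simp [hind]
        simp [this]
    · have : independentSets u ∅ (fun _ => True) = {∅} := by ext t; simp [hind]
      simp [this]
  | insert e s he ih =>
    have hus : ∀ i ∈ s, IsEdgeVec (u i) := fun i hi => hu i (Finset.mem_insert_of_mem hi)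
    have hue := hu e (Finset.mem_insert_self _ _)
    rw [zonotope_insert u he]
    by_cases h0 : u e = 0
    · have hA : zonotope u s + segment ℝ 0 (u e) = zonotope u s := by
        simp [h0]
      rw [hA, independentSets_insert_of_eq_zero u h0, independentSets_insert_of_eq_zero u h0]
      exact ih u hus
    · cases n with
      | zero => exact absurd (Subsingleton.elim _ _) h0
      | succ m =>
        obtain ⟨f, hker, hf, h⟩ := hue.exists_contraction h0
        obtain ⟨hvol, hcard⟩ := h ι u s hus
        have ih' := ih (f ∘ u) fun i hi => hf _ (hus i hi)
        rw [hvol, hcard, card_independentSets_insert u he h0 f hker,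
          card_independentSets_insert u he h0 f hker, (ih u hus).1, (ih u hus).2, ih'.1, ih'.2]
        simp

section Graph

variable {n : ℕ}

/-- The vertices of the graph in reduced coordinates, with the last vertex as root. -/
def reducedVec (n : ℕ) (c : Fin (n + 1)) : Fin n → ℝ := fun i => stdVec (n + 1) c i.castSucc

lemma isVertexVec_reducedVec (c : Fin (n + 1)) : IsVertexVec (reducedVec n c) := by
  cases c using Fin.lastCases with
  | last => exact .inl (by ext i; simp [reducedVec, stdVec, Fin.castSucc_ne_last])
  | cast j => exact .inr ⟨j, by ext i; simp [reducedVec, stdVec, Pi.single_apply]⟩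

lemma isEdgeVec_reducedVec_sub (c d : Fin (n + 1)) :
    IsEdgeVec (reducedVec n c - reducedVec n d) :=
  ⟨_, _, isVertexVec_reducedVec c, isVertexVec_reducedVec d, rfl⟩

/-- Every function on the vertices extends, up to a constant, to a linear functional. -/
lemma exists_functional (g : Fin (n + 1) → ℝ) :
    ∃ l : (Fin n → ℝ) →ₗ[ℝ] ℝ, ∀ c c', l (reducedVec n c - reducedVec n c') = g c - g c' := by
  refine ⟨∑ i, (g i.castSucc - g (Fin.last n)) • LinearMap.proj i, ?_⟩
  have h : ∀ c, (∑ i, (g i.castSucc - g (Fin.last n)) • LinearMap.proj i : (Fin n → ℝ) →ₗ[ℝ] ℝ)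
      (reducedVec n c) = g c - g (Fin.last n) := by
    intro c
    cases c using Fin.lastCases with
    | last => simp [reducedVec, stdVec, Fin.castSucc_ne_last]
    | cast j => simp [reducedVec, stdVec]
  intro c c'
  rw [map_sub, h, h]
  ring

variable {a b : Sym2 (Fin (n + 1)) → Fin (n + 1)}

lemma sub_mem_span_iff_reachable (hab : ∀ e, e = s(a e, b e)) (T : Finset (Sym2 (Fin (n + 1))))
    (p q : Fin (n + 1)) :
    reducedVec n p - reducedVec n q ∈ Submodule.span ℝ
        ((fun e => reducedVec n (a e) - reducedVec n (b e)) '' (T : Set (Sym2 (Fin (n + 1))))) ↔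
      (SimpleGraph.fromEdgeSet (T : Set (Sym2 (Fin (n + 1))))).Reachable p q := by
  classical
  constructor
  · intro h
    by_contra hpq
    obtain ⟨l, hl⟩ := exists_functional fun c =>
      if (SimpleGraph.fromEdgeSet (T : Set (Sym2 (Fin (n + 1))))).Reachable p c then (1 : ℝ) else 0
    have hker : Submodule.span ℝ ((fun e => reducedVec n (a e) - reducedVec n (b e)) ''
        (T : Set (Sym2 (Fin (n + 1))))) ≤ LinearMap.ker l := by
      rw [Submodule.span_le]
      rintro _ ⟨e, he, rfl⟩
      have hr : (SimpleGraph.fromEdgeSet (T : Set (Sym2 (Fin (n + 1))))).Reachable (a e) (b e) := by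
        by_cases h : a e = b e
        · rw [h]
        · refine SimpleGraph.Adj.reachable ?_
          rw [SimpleGraph.fromEdgeSet_adj]
          exact ⟨hab e ▸ he, h⟩
      have hiff : (SimpleGraph.fromEdgeSet (T : Set (Sym2 (Fin (n + 1))))).Reachable p (a e) ↔
          (SimpleGraph.fromEdgeSet (T : Set (Sym2 (Fin (n + 1))))).Reachable p (b e) :=
        ⟨fun h => h.trans hr, fun h => h.trans hr.symm⟩
      simp [hl, hiff]
    have := hker h
    simp [hl, hpq] at this
  · rintro ⟨walk⟩
    induction walk with
    | nil => simp
    | @cons x y z hadj _ ih =>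
      rw [← sub_add_sub_cancel _ (reducedVec n y)]
      refine Submodule.add_mem _ ?_ ih
      rw [SimpleGraph.fromEdgeSet_adj] at hadj
      have hmem := SetLike.mem_coe.1 (Submodule.subset_span (R := ℝ) (Set.mem_image_of_mem
        (fun e => reducedVec n (a e) - reducedVec n (b e)) hadj.1))
      rcases Sym2.eq_iff.1 (hab s(x, y)) with ⟨h1, h2⟩ | ⟨h1, h2⟩
      · simpa only [← h1, ← h2] using hmem
      · rw [← neg_sub]
        exact Submodule.neg_mem _ (by simpa only [← h1, ← h2] using hmem)

lemma isAcyclic_iff_linearIndepOn (hab : ∀ e, e = s(a e, b e)) (T : Finset (Sym2 (Fin (n + 1))))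
    (hT : ∀ e ∈ T, ¬ e.IsDiag) :
    (SimpleGraph.fromEdgeSet (T : Set (Sym2 (Fin (n + 1))))).IsAcyclic ↔
      LinearIndepOn ℝ (fun e => reducedVec n (a e) - reducedVec n (b e))
        (T : Set (Sym2 (Fin (n + 1)))) := by
  classical
  induction T using Finset.induction_on with
  | empty => simp
  | insert e T he ih =>
    rw [Finset.coe_insert, linearIndepOn_insert (by simpa using he),
      sub_mem_span_iff_reachable hab, ← ih fun i hi => hT i (Finset.mem_insert_of_mem hi),
      Set.insert_eq, Set.union_comm, SimpleGraph.fromEdgeSet_union]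
    have hne : a e ≠ b e := by
      have := hT e (Finset.mem_insert_self _ _)
      rwa [hab e, Sym2.mk_isDiag_iff] at this
    have hedge : SimpleGraph.fromEdgeSet {e} = SimpleGraph.edge (a e) (b e) := by
      rw [SimpleGraph.edge, ← hab e]
    rw [hedge, SimpleGraph.isAcyclic_sup_fromEdgeSet_iff, SimpleGraph.fromEdgeSet_adj, ← hab e]
    simp [he, hne]

lemma isTree_iff_isAcyclic_and_card (T : Finset (Sym2 (Fin (n + 1))))
    (hT : ∀ e ∈ T, ¬ e.IsDiag) :
    (SimpleGraph.fromEdgeSet (T : Set (Sym2 (Fin (n + 1))))).IsTree ↔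
      (SimpleGraph.fromEdgeSet (T : Set (Sym2 (Fin (n + 1))))).IsAcyclic ∧ T.card = n := by
  have hE : (SimpleGraph.fromEdgeSet (T : Set (Sym2 (Fin (n + 1))))).edgeSet = T := by
    rw [SimpleGraph.edgeSet_fromEdgeSet, sdiff_eq_left, Set.disjoint_left]
    exact fun e he hd => hT e he hd
  have hcard : Nat.card (SimpleGraph.fromEdgeSet (T : Set (Sym2 (Fin (n + 1))))).edgeSet =
      T.card := by
    rw [hE]; simp
  constructor
  · intro h
    have := (SimpleGraph.isTree_iff_connected_and_card.1 h).2
    rw [hcard] at this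
    exact ⟨h.isAcyclic, by simpa using this⟩
  · rintro ⟨h, hn⟩
    obtain ⟨F, hTF, -, hF⟩ := SimpleGraph.connected_top.exists_isTree_le_of_le_of_isAcyclic
      le_top h
    have hFcard := (SimpleGraph.isTree_iff_connected_and_card.1 hF).2
    have hEF := Set.eq_of_subset_of_ncard_le (SimpleGraph.edgeSet_mono hTF) (by
      rw [← Nat.card_coe_set_eq, ← Nat.card_coe_set_eq, hcard, hn]
      simp at hFcard
      simp [hFcard])
    rwa [SimpleGraph.edgeSet_inj.1 hEF]

lemma edgeSegment_mk (x y : Fin n) :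
    edgeSegment n s(x, y) = segment ℝ (stdVec n x) (stdVec n y) := rfl

lemma image_castSucc_sum_edgeSegment (hab : ∀ e, e = s(a e, b e))
    (E : Finset (Sym2 (Fin (n + 1)))) :
    (fun t : Fin (n + 1) → ℝ => fun i : Fin n => t i.castSucc) ''
        ∑ e ∈ E, edgeSegment (n + 1) e =
      (fun x => ∑ e ∈ E, reducedVec n (b e) + x) ''
        zonotope (fun e => reducedVec n (a e) - reducedVec n (b e)) E := by
  change (LinearMap.funLeft ℝ ℝ (Fin.castSucc (n := n))) '' _ = _
  rw [Set.image_finsetSum, zonotope, ← Set.singleton_add, ← Set.finsetSum_singleton,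
    ← Finset.sum_add_distrib]
  refine Finset.sum_congr rfl fun e _ => ?_
  rw [Set.singleton_add, segment_translate_image, add_zero, add_sub_cancel, segment_symm]
  conv_lhs => rw [hab e, edgeSegment_mk]
  exact image_segment ℝ (LinearMap.funLeft ℝ ℝ (Fin.castSucc (n := n))).toAffineMap _ _

lemma sum_coord_of_mem_sum_edgeSegment (hab : ∀ e, e = s(a e, b e))
    {E : Finset (Sym2 (Fin (n + 1)))} {x : Fin (n + 1) → ℝ}
    (hx : x ∈ ∑ e ∈ E, edgeSegment (n + 1) e) : ∑ i, x i = E.card := by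
  let l : (Fin (n + 1) → ℝ) →ₗ[ℝ] ℝ := ∑ i, LinearMap.proj i
  have hl : ∀ c, l (stdVec (n + 1) c) = 1 := fun c => by simp [l, stdVec]
  have h : l '' (∑ e ∈ E, edgeSegment (n + 1) e) = {(E.card : ℝ)} := by
    rw [Set.image_finsetSum]
    have : ∀ e ∈ E, l '' edgeSegment (n + 1) e = {1} := by
      intro e _
      rw [hab e, edgeSegment_mk]
      have := image_segment ℝ l.toAffineMap (stdVec (n + 1) (a e)) (stdVec (n + 1) (b e))
      simpa [hl] using this
    rw [Finset.sum_congr rfl this, Set.finsetSum_singleton]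
    simp
  have := h ▸ Set.mem_image_of_mem l hx
  simpa [l] using this

lemma ncard_lattice_sum_edgeSegment (hab : ∀ e, e = s(a e, b e))
    (E : Finset (Sym2 (Fin (n + 1)))) :
    (latticePoints (∑ e ∈ E, edgeSegment (n + 1) e)).ncard =
      (latticePoints ((fun t : Fin (n + 1) → ℝ => fun i : Fin n => t i.castSucc) ''
        ∑ e ∈ E, edgeSegment (n + 1) e)).ncard := by
  refine Set.ncard_congr (fun z _ i => z i.castSucc) (fun z hz => ⟨_, hz, rfl⟩) ?_ ?_
  · intro z z' hz hz' h
    have h1 := sum_coord_of_mem_sum_edgeSegment hab hz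
    have h2 := sum_coord_of_mem_sum_edgeSegment hab hz'
    rw [← h2, Fin.sum_univ_castSucc, Fin.sum_univ_castSucc] at h1
    have hcast : ∀ i : Fin n, z i.castSucc = z' i.castSucc := congrFun h
    simp only [hcast, add_right_inj] at h1
    funext i
    cases i using Fin.lastCases with
    | last => exact_mod_cast h1
    | cast i => exact hcast i
  · rintro y ⟨x, hx, hxy⟩
    have hsum := sum_coord_of_mem_sum_edgeSegment hab hx
    have hxy' : ∀ i : Fin n, x i.castSucc = y i := congrFun hxy
    rw [Fin.sum_univ_castSucc] at hsum
    simp only [hxy'] at hsum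
    refine ⟨Fin.snoc y (E.card - ∑ i, y i), ?_, by ext i; simp⟩
    have : (fun i => ((Fin.snoc y (E.card - ∑ i, y i) : Fin (n + 1) → ℤ) i : ℝ)) = x := by
      funext i
      cases i using Fin.lastCases with
      | last => simp; linarith
      | cast i => simp [hxy']
    rwa [latticePoints, Set.mem_ofPred_eq, this]

end Graph

theorem stmt14 (n : ℕ) (Γ : SimpleGraph (Fin (n + 1))) [DecidableRel Γ.Adj]
    (hconn : Γ.Connected) :
    projVol n (∑ e ∈ Γ.edgeFinset, edgeSegment (n + 1) e) =
      (Set.ncard {T : Finset (Sym2 (Fin (n + 1))) |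
        (T : Set (Sym2 (Fin (n + 1)))) ⊆ Γ.edgeSet ∧
        (SimpleGraph.fromEdgeSet (T : Set (Sym2 (Fin (n + 1))))).IsTree} : ℝ) ∧
    Set.ncard {b : Fin (n + 1) → ℤ |
        (fun i => (b i : ℝ)) ∈ ∑ e ∈ Γ.edgeFinset, edgeSegment (n + 1) e} =
      Set.ncard {F : Finset (Sym2 (Fin (n + 1))) |
        (F : Set (Sym2 (Fin (n + 1)))) ⊆ Γ.edgeSet ∧
        (SimpleGraph.fromEdgeSet (F : Set (Sym2 (Fin (n + 1))))).IsAcyclic} := by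
  have hpair : ∀ e : Sym2 (Fin (n + 1)), ∃ p q, e = s(p, q) := fun e =>
    e.ind fun p q => ⟨p, q, rfl⟩
  choose a b hab using hpair
  have hdiag : ∀ T : Finset (Sym2 (Fin (n + 1))), (T : Set (Sym2 (Fin (n + 1)))) ⊆ Γ.edgeSet →
      ∀ e ∈ T, ¬ e.IsDiag := fun T hT e he => Γ.not_isDiag_of_mem_edgeSet (hT he)
  obtain ⟨hvol, hlat⟩ := volume_and_ncard_latticePoints_zonotope Γ.edgeFinset
    (fun e => reducedVec n (a e) - reducedVec n (b e)) fun e _ => isEdgeVec_reducedVec_sub _ _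
  constructor
  · rw [projVol, image_castSucc_sum_edgeSegment hab, Set.image_add_left, measure_preimage_add,
      hvol, ENNReal.toReal_natCast, ← Set.ncard_coe_finset]
    congr 2
    ext T
    rw [Finset.mem_coe, mem_independentSets, ← Finset.coe_subset, SimpleGraph.coe_edgeFinset]
    refine and_congr_right fun hT => ?_
    rw [isTree_iff_isAcyclic_and_card T (hdiag T hT),
      isAcyclic_iff_linearIndepOn hab T (hdiag T hT)]
  · obtain ⟨v, hv⟩ : ∃ v : Fin n → ℤ,
        ∑ e ∈ Γ.edgeFinset, reducedVec n (b e) = fun i => (v i : ℝ) := by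
      choose f hf using fun c => (isVertexVec_reducedVec (n := n) c).exists_int
      refine ⟨∑ e ∈ Γ.edgeFinset, f (b e), ?_⟩
      ext i
      simp [hf]
    refine (ncard_lattice_sum_edgeSegment hab Γ.edgeFinset).trans ?_
    rw [image_castSucc_sum_edgeSegment hab, hv, ncard_latticePoints_translate, hlat,
      ← Set.ncard_coe_finset]
    congr 1
    ext T
    rw [Finset.mem_coe, mem_independentSets, ← Finset.coe_subset, SimpleGraph.coe_edgeFinset,
      and_true]
    exact and_congr_right fun hT => (isAcyclic_iff_linearIndepOn hab T (hdiag T hT)).symm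
end

section
/- Let n ≥ 1. Then the following identity holds in the polynomial ring ℚ[t_1,…,t_{n−1}]: Σ_{(a_1,…,a_{n−1}) ∈ ℕ^{n−1}} N(a_1,…,a_{n−1}) · (t_1^{a_1}/a_1!) ⋯ (t_{n−1}^{a_{n−1}}/a_{n−1}!) = Π_{1 ≤ i < j ≤ n} (t_i + t_{i+1} + ⋯ + t_{j−1})/(j − i), where only finitely many of the numbers N(a_1,…,a_{n−1}) are nonzero. -/
open MvPolynomial

/-- The cells `(i,j)` with `1 ≤ i ≤ j ≤ n` of the shifted triangular shape
`(n, n−1, …, 1)` (here `0`-indexed). -/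
def ShiftedCell (n : ℕ) : Type := {p : Fin n × Fin n // p.1 ≤ p.2}

/-- A standard shifted Young tableau of triangular shape `(n, n−1, …, 1)`: a bijection
from the cells onto `{1, …, n(n+1)/2}` increasing along rows and columns. -/
def IsShiftedSYT (n : ℕ) (T : ShiftedCell n → ℕ) : Prop :=
  Function.Injective T ∧
  Set.range T = Set.Icc 1 (n * (n + 1) / 2) ∧
  (∀ p q : ShiftedCell n, ((p.1.1 : ℕ) + 1 = (q.1.1 : ℕ) ∧ p.1.2 = q.1.2) → T p < T q) ∧
  (∀ p q : ShiftedCell n, (p.1.1 = q.1.1 ∧ (p.1.2 : ℕ) + 1 = (q.1.2 : ℕ)) → T p < T q)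

/-- The `i`-th diagonal entry `T(i,i)` of a shifted tableau. -/
def diagEntry (n : ℕ) (T : ShiftedCell n → ℕ) (i : Fin n) : ℕ := T ⟨(i, i), le_refl i⟩

/-- `N(a_1,…,a_n)`: the number of standard shifted Young tableaux of triangular shape
`(n+1, n, …, 1)` whose diagonal vector `(d_1,…,d_{n+1})` satisfies `d_1 = 1` and
`d_{i+1} = d_i + a_i + 1`. -/
noncomputable def Ntab (n : ℕ) (a : Fin n → ℕ) : ℕ :=
  Set.ncard {T : ShiftedCell (n + 1) → ℕ | IsShiftedSYT (n + 1) T ∧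
    diagEntry (n + 1) T 0 = 1 ∧
    ∀ i : Fin n, diagEntry (n + 1) T i.succ = diagEntry (n + 1) T i.castSucc + a i + 1}


/-- The standard fillings of a finite set `S` of cells: injective on `S` with values in
`{1, …, |S|}`, zero off `S`, and increasing along `R`, all `R`-predecessors being in `S`. -/
noncomputable def standardFillings {α : Type*} [Fintype α] (R : α → α → Prop) (S : Finset α) :
    Finset (α → ℕ) := by
  classical
  exact (Fintype.piFinset fun _ => Finset.range (S.card + 1)).filter fun T =>
    (∀ a, a ∈ S ↔ 0 < T a) ∧ Set.InjOn T S ∧ ∀ a b, R a b → b ∈ S → 0 < T a ∧ T a < T b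

section StandardFillings

variable {α : Type*} [Fintype α] {R : α → α → Prop} {S : Finset α} {T : α → ℕ}

theorem mem_standardFillings :
    T ∈ standardFillings R S ↔ (∀ a, T a ≤ S.card) ∧ (∀ a, a ∈ S ↔ 0 < T a) ∧
      Set.InjOn T S ∧ ∀ a b, R a b → b ∈ S → 0 < T a ∧ T a < T b := by
  simp [standardFillings, Fintype.mem_piFinset]

theorem exists_eq_of_mem_standardFillings (hT : T ∈ standardFillings R S) {k : ℕ}
    (hk : 0 < k) (hkS : k ≤ S.card) : ∃ p ∈ S, T p = k := by
  obtain ⟨hle, hpos, hinj, -⟩ := mem_standardFillings.1 hT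
  have hsurj := Finset.surjOn_of_injOn_of_card_le (s := S) (t := Finset.Icc 1 S.card) T
    (fun a ha => by
      have := (hpos a).1 ha
      simpa using ⟨this, hle a⟩) hinj (by simp)
  obtain ⟨p, hp, h⟩ := hsurj (by simpa using ⟨hk, hkS⟩ : k ∈ (Finset.Icc 1 S.card : Set ℕ))
  exact ⟨p, hp, h⟩

theorem standardFillings_empty : standardFillings R (∅ : Finset α) = {fun _ => 0} := by
  ext T
  rw [mem_standardFillings]
  simp only [Finset.card_empty, Finset.notMem_empty, Finset.mem_singleton, funext_iff]
  constructor
  · rintro ⟨h, -⟩ a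
    simpa using h a
  · intro h
    simp [h]

variable [DecidableEq α]

theorem update_mem_standardFillings (hS : ∀ a b, R a b → b ∈ S → a ∈ S)
    {p : α} (hp : p ∈ S) (hmax : ∀ b ∈ S, ¬ R p b) (hT : T ∈ standardFillings R (S.erase p)) :
    Function.update T p S.card ∈ standardFillings R S := by
  obtain ⟨hle, hpos, hinj, hmono⟩ := mem_standardFillings.1 hT
  have hcard := Finset.card_erase_of_mem hp
  have hS0 : 0 < S.card := Finset.card_pos.2 ⟨p, hp⟩
  refine mem_standardFillings.2 ⟨fun a => ?_, fun a => ?_, fun a ha b hb hab => ?_,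
    fun a b hab hb => ?_⟩
  · by_cases h : a = p
    · simp [h]
    · have := hle a
      rw [Function.update_of_ne h]
      omega
  · by_cases h : a = p
    · simp [h, hp, hS0]
    · rw [Function.update_of_ne h, ← hpos]
      simp [h]
  · by_cases h : a = p <;> by_cases h' : b = p
    · rw [h, h']
    · subst h
      have := hle b
      rw [Function.update_self, Function.update_of_ne h'] at hab
      omega
    · subst h'
      have := hle a
      rw [Function.update_self, Function.update_of_ne h] at hab
      omega
    · rw [Function.update_of_ne h, Function.update_of_ne h'] at hab
      exact hinj (by simpa [h] using ha) (by simpa [h'] using hb) hab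
  · have hap : a ≠ p := fun h => hmax b hb (h ▸ hab)
    by_cases h : b = p
    · subst h
      have := hle a
      have := (hpos a).1 (by simpa [hap] using hS a b hab hb)
      rw [Function.update_self, Function.update_of_ne hap]
      omega
    · rw [Function.update_of_ne hap, Function.update_of_ne h]
      exact hmono a b hab (by simpa [h] using hb)

theorem update_zero_mem_standardFillings {p : α} (hp : p ∈ S) (hT : T ∈ standardFillings R S)
    (hpT : T p = S.card) :
    (∀ b ∈ S, ¬ R p b) ∧ Function.update T p 0 ∈ standardFillings R (S.erase p) := by
  obtain ⟨hle, hpos, hinj, hmono⟩ := mem_standardFillings.1 hT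
  have hcard := Finset.card_erase_of_mem hp
  have hmax : ∀ b ∈ S, ¬ R p b := fun b hb hpb => by
    have := hmono p b hpb hb
    have := hle b
    omega
  refine ⟨hmax, mem_standardFillings.2 ⟨fun a => ?_, fun a => ?_, fun a ha b hb hab => ?_,
    fun a b hab hb => ?_⟩⟩
  · by_cases h : a = p
    · simp [h]
    · have := hle a
      have : T a ≠ S.card := fun h' => by
        by_cases haS : a ∈ S
        · exact h (hinj haS hp (h'.trans hpT.symm))
        · have := Finset.card_pos.2 ⟨p, hp⟩
          exact haS ((hpos a).2 (by omega))
      rw [Function.update_of_ne h]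
      omega
  · by_cases h : a = p
    · simp [h]
    · simp [h, hpos]
  · have ha' := Finset.mem_erase.1 ha
    have hb' := Finset.mem_erase.1 hb
    rw [Function.update_of_ne ha'.1, Function.update_of_ne hb'.1] at hab
    exact hinj ha'.2 hb'.2 hab
  · have hb' := Finset.mem_erase.1 hb
    have hap : a ≠ p := fun h => hmax b hb'.2 (h ▸ hab)
    rw [Function.update_of_ne hap, Function.update_of_ne hb'.1]
    exact hmono a b hab hb'.2

/-- Summing over standard fillings by removing the cell with the largest entry. -/
theorem sum_standardFillings {M : Type*} [AddCommMonoid M]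
    (hS : ∀ a b, R a b → b ∈ S → a ∈ S) (hne : S.Nonempty)
    [DecidablePred fun p => ∀ b ∈ S, ¬ R p b] (f : (α → ℕ) → M) :
    ∑ T ∈ standardFillings R S, f T =
      ∑ p ∈ S with ∀ b ∈ S, ¬ R p b, ∑ T ∈ standardFillings R (S.erase p),
        f (Function.update T p S.card) := by
  rw [Finset.sum_sigma']
  symm
  refine Finset.sum_bij (fun x _ => Function.update x.2 x.1 S.card) ?_ ?_ ?_ fun _ _ => rfl
  · rintro ⟨p, T⟩ h
    simp only [Finset.mem_sigma, Finset.mem_filter] at h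
    exact update_mem_standardFillings hS h.1.1 h.1.2 h.2
  · rintro ⟨p, T⟩ h ⟨q, U⟩ h' heq
    simp only [Finset.mem_sigma, Finset.mem_filter] at h h' heq
    have hpq : p = q := by
      by_contra hpq
      have h1 := congrFun heq q
      rw [Function.update_self, Function.update_of_ne (Ne.symm hpq)] at h1
      have h2 := (mem_standardFillings.1 h.2).1 q
      have h3 := Finset.card_erase_of_mem h.1.1
      have h4 := Finset.card_pos.2 hne
      omega
    subst hpq
    congr
    funext a
    by_cases ha : a = p
    · subst ha
      have h1 := ((mem_standardFillings.1 h.2).2.1 a).not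
      have h2 := ((mem_standardFillings.1 h'.2).2.1 a).not
      simp only [Finset.mem_erase, ne_eq, not_true_eq_false, false_and, not_false_eq_true,
        true_iff, not_lt, nonpos_iff_eq_zero] at h1 h2
      rw [h1, h2]
    · simpa [ha] using congrFun heq a
  · intro T hT
    obtain ⟨p, hp, hpT⟩ := exists_eq_of_mem_standardFillings hT (Finset.card_pos.2 hne) le_rfl
    obtain ⟨hmax, hmem⟩ := update_zero_mem_standardFillings hp hT hpT
    exact ⟨⟨p, Function.update T p 0⟩, by simpa using ⟨⟨hp, hmax⟩, hmem⟩, by simp [← hpT]⟩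

end StandardFillings

/-- The divided power `X ^ k / k!`. -/
noncomputable def dividedPow (k : ℕ) : Polynomial ℚ :=
  Polynomial.C ((k.factorial : ℚ)⁻¹) * Polynomial.X ^ k

theorem dividedPow_zero : dividedPow 0 = 1 := by simp [dividedPow]

theorem eval_dividedPow (x : ℚ) (k : ℕ) :
    (dividedPow k).eval x = (k.factorial : ℚ)⁻¹ * x ^ k := by simp [dividedPow]

theorem eval_zero_dividedPow {k : ℕ} (hk : k ≠ 0) : (dividedPow k).eval 0 = 0 := by
  simp [eval_dividedPow, hk]

theorem derivative_dividedPow_succ (k : ℕ) :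
    Polynomial.derivative (dividedPow (k + 1)) = dividedPow k := by
  have : (k : ℚ) + 1 ≠ 0 := by positivity
  rw [dividedPow, Polynomial.derivative_C_mul_X_pow, dividedPow, Nat.factorial_succ]
  congr 2
  push_cast
  field_simp

theorem derivative_det {ι : Type*} [Fintype ι] [DecidableEq ι] {A : Type*} [CommRing A]
    (M : Matrix ι ι (Polynomial A)) :
    Polynomial.derivative M.det =
      ∑ j, (M.updateCol j fun i => Polynomial.derivative (M i j)).det := by
  simp only [Matrix.det_apply, Polynomial.derivative_sum]
  rw [Finset.sum_comm]
  refine Finset.sum_congr rfl fun σ _ => ?_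
  rw [Polynomial.derivative_smul, Polynomial.derivative_prod_finset, Finset.smul_sum]
  refine Finset.sum_congr rfl fun j _ => ?_
  congr 1
  rw [← Finset.prod_erase_mul _ _ (Finset.mem_univ j), Matrix.updateCol_self]
  congr 1
  refine Finset.prod_congr rfl fun i hi => ?_
  rw [Matrix.updateCol_ne (Finset.ne_of_mem_erase hi)]

theorem polynomial_eq_of_derivative_eq {p q : Polynomial ℚ}
    (h : Polynomial.derivative p = Polynomial.derivative q) (h0 : p.eval 0 = q.eval 0) :
    p = q := by
  have h1 : Polynomial.derivative (p - q) = 0 := by simp [h]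
  rw [Polynomial.derivative_eq_zero, Polynomial.natDegree_eq_zero] at h1
  obtain ⟨c, hc⟩ := h1
  have h2 : (p - q).eval 0 = 0 := by simp [h0]
  rw [← hc, Polynomial.eval_C] at h2
  rw [h2, Polynomial.C_0] at hc
  exact sub_eq_zero.1 hc.symm

/-- Lower the `i`-th part by one. -/
def lowerPart (l : ℕ → ℕ) (i : ℕ) : ℕ → ℕ := Function.update l i (l i - 1)

/-- The matrix with entries `(X + t_i + ⋯ + t_{m-1}) ^ (l_j - 1) / (l_j - 1)!`. -/
noncomputable def shapeMatrix (t : ℕ → ℚ) (m : ℕ) (l : ℕ → ℕ) :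
    Matrix (Fin (m + 1)) (Fin (m + 1)) (Polynomial ℚ) :=
  Matrix.of fun i j => (dividedPow (l j - 1)).comp
    (Polynomial.X + Polynomial.C (∑ k ∈ Finset.Ico (i : ℕ) m, t k))

/-- `l` is a strict partition with exactly `m + 1` parts `n ≥ l 0 > ⋯ > l m > 0`. -/
structure IsStrictShape (n m : ℕ) (l : ℕ → ℕ) : Prop where
  lt : ∀ i ≤ m, l (i + 1) < l i
  zero : ∀ i, m < i → l i = 0
  le : l 0 ≤ n

namespace IsStrictShape

variable {n m : ℕ} {l : ℕ → ℕ}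

theorem add_le (h : IsStrictShape n m l) {i : ℕ} (hi : i ≤ m) : l i + i ≤ n := by
  induction i with
  | zero => simpa using h.le
  | succ i ih =>
    have := h.lt i (by omega)
    have := ih (by omega)
    omega

theorem pos (h : IsStrictShape n m l) {i : ℕ} (hi : i ≤ m) : 0 < l i :=
  (Nat.zero_le _).trans_lt (h.lt i hi)

theorem le_of_pos (h : IsStrictShape n m l) {i : ℕ} (hi : 0 < l i) : i ≤ m := by
  by_contra hc
  have := h.zero i (by omega)
  omega

theorem eq_of_eq_one (h : IsStrictShape n m l) {i : ℕ} (hi : l i = 1) : i = m := by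
  have h1 := h.le_of_pos (i := i) (by omega)
  have h2 := h.lt i h1
  by_contra hne
  have := h.pos (i := i + 1) (by omega)
  omega

theorem lowerPart (h : IsStrictShape n m l) {i : ℕ} (hi : l (i + 1) + 1 < l i) :
    IsStrictShape n m (lowerPart l i) where
  lt k hk := by
    have := h.lt k hk
    unfold _root_.lowerPart
    simp only [Function.update_apply]
    split_ifs with h1 h2 h2
    · omega
    · subst h1; omega
    · subst h2; omega
    · omega
  zero k hk := by
    have := h.zero k hk
    unfold _root_.lowerPart
    simp only [Function.update_apply]
    split_ifs with h1
    · subst h1; omega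
    · exact this
  le := by
    have := h.le
    unfold _root_.lowerPart
    simp only [Function.update_apply]
    split_ifs with h1
    · subst h1; omega
    · exact this

theorem lowerPart_last (h : IsStrictShape n (m + 1) l) (hm : l (m + 1) = 1) :
    IsStrictShape n m (_root_.lowerPart l (m + 1)) where
  lt k hk := by
    have := h.lt k (by omega)
    unfold _root_.lowerPart
    simp only [Function.update_apply]
    split_ifs <;> omega
  zero k hk := by
    unfold _root_.lowerPart
    simp only [Function.update_apply]
    split_ifs with h1
    · omega
    · exact h.zero k (by omega)
  le := by
    have := h.le
    unfold _root_.lowerPart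
    simpa [Function.update_apply] using this

end IsStrictShape

theorem derivative_det_shapeMatrix (t : ℕ → ℚ) {n m : ℕ} {l : ℕ → ℕ} (h : IsStrictShape n m l) :
    Polynomial.derivative (shapeMatrix t m l).det =
      ∑ i ∈ Finset.range (m + 1),
        if l (i + 1) + 1 < l i then (shapeMatrix t m (lowerPart l i)).det else 0 := by
  rw [derivative_det, Finset.sum_range]
  refine Finset.sum_congr rfl fun j _ => ?_
  have hj := h.lt j (by omega)
  by_cases h1 : l j = 1
  · rw [if_neg (by omega)]
    refine Matrix.det_eq_zero_of_column_eq_zero j fun i => ?_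
    simp [shapeMatrix, h1, dividedPow_zero]
  · have hcol : ((shapeMatrix t m l).updateCol j fun i =>
        Polynomial.derivative (shapeMatrix t m l i j)) = shapeMatrix t m (lowerPart l j) := by
      ext1 i k
      by_cases hk : k = j
      · subst hk
        obtain ⟨q, hq⟩ : ∃ q, l k = q + 2 := ⟨l k - 2, by omega⟩
        rw [Matrix.updateCol_self]
        simp [shapeMatrix, lowerPart, hq, Polynomial.derivative_comp, derivative_dividedPow_succ]
      · have hk' : (k : ℕ) ≠ j := fun h => hk (Fin.ext h)
        rw [Matrix.updateCol_ne hk]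
        simp [shapeMatrix, lowerPart, Function.update_of_ne hk']
    rw [hcol]
    split_ifs with h2
    · rfl
    · have hjm : (j : ℕ) + 1 < m + 1 := by
        have := h.zero (j + 1)
        omega
      refine Matrix.det_zero_of_column_eq (i := j) (j := ⟨j + 1, hjm⟩)
        (by simp [Fin.ext_iff]) fun i => ?_
      simp only [shapeMatrix, lowerPart, Matrix.of_apply, Function.update_self]
      rw [Function.update_of_ne (by omega)]
      congr 2
      omega

theorem eval_shapeMatrix (t : ℕ → ℚ) (m : ℕ) (l : ℕ → ℕ) (i j : Fin (m + 1)) (x : ℚ) :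
    (shapeMatrix t m l i j).eval x =
      (dividedPow (l j - 1)).eval (x + ∑ k ∈ Finset.Ico (i : ℕ) m, t k) := by
  simp [shapeMatrix, Polynomial.eval_finsetSum]

theorem eval_det_shapeMatrix (t : ℕ → ℚ) (m : ℕ) (l : ℕ → ℕ) (x : ℚ) :
    (shapeMatrix t m l).det.eval x = ((shapeMatrix t m l).map (Polynomial.eval x)).det :=
  (Polynomial.evalRingHom x).map_det _

theorem eval_zero_det_shapeMatrix_of_ne (t : ℕ → ℚ) {n m : ℕ} {l : ℕ → ℕ}
    (h : IsStrictShape n m l) (hm : l m ≠ 1) : (shapeMatrix t m l).det.eval 0 = 0 := by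
  rw [eval_det_shapeMatrix]
  refine Matrix.det_eq_zero_of_row_eq_zero (Fin.last m) fun j => ?_
  have h1 := h.pos (i := j) (by omega)
  have h2 : l j ≠ 1 := fun h2 => hm (h.eq_of_eq_one h2 ▸ h2)
  simp [eval_shapeMatrix, eval_zero_dividedPow (show l j - 1 ≠ 0 by omega)]

theorem eval_zero_det_shapeMatrix_succ (t : ℕ → ℚ) {n m : ℕ} {l : ℕ → ℕ}
    (h : IsStrictShape n (m + 1) l) (hm : l (m + 1) = 1) :
    (shapeMatrix t (m + 1) l).det.eval 0 =
      (shapeMatrix t m (lowerPart l (m + 1))).det.eval (t m) := by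
  rw [eval_det_shapeMatrix, eval_det_shapeMatrix, Matrix.det_succ_row _ (Fin.last (m + 1)),
    Fin.sum_univ_castSucc, Finset.sum_eq_zero, zero_add]
  · have hlast : (shapeMatrix t (m + 1) l).map (Polynomial.eval 0) (Fin.last (m + 1))
        (Fin.last (m + 1)) = 1 := by
      simp [eval_shapeMatrix, hm, dividedPow_zero]
    rw [hlast, Even.neg_one_pow ⟨_, rfl⟩, one_mul, one_mul]
    congr 1
    ext i j
    have hj : (j : ℕ) ≠ m + 1 := by omega
    simp only [Matrix.submatrix_apply, Matrix.map_apply, eval_shapeMatrix, Fin.succAbove_last,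
      Fin.val_castSucc, lowerPart, Function.update_of_ne hj, zero_add]
    rw [Finset.sum_Ico_succ_top (by omega), add_comm]
  · intro j _
    have h1 := h.pos (i := j.castSucc) (by simp)
    have h2 : l j.castSucc ≠ 1 := fun h2 => by
      have := h.eq_of_eq_one h2
      simp at this
      omega
    rw [Matrix.map_apply, eval_shapeMatrix]
    simp [eval_zero_dividedPow (show l (j : ℕ) - 1 ≠ 0 by simp at h1 h2; omega)]

section ShiftedShapes

variable {n m : ℕ} {l : ℕ → ℕ}

noncomputable instance (n : ℕ) : Fintype (ShiftedCell n) :=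
  inferInstanceAs (Fintype {p : Fin n × Fin n // p.1 ≤ p.2})

instance (n : ℕ) : DecidableEq (ShiftedCell n) :=
  inferInstanceAs (DecidableEq {p : Fin n × Fin n // p.1 ≤ p.2})

namespace ShiftedCell

/-- The row of a cell. -/
def row (p : ShiftedCell n) : ℕ := p.1.1

/-- The column of a cell. -/
def col (p : ShiftedCell n) : ℕ := p.1.2

/-- The cell in row `i` and column `j`. -/
def mk (i j : ℕ) (hij : i ≤ j) (hj : j < n) : ShiftedCell n :=
  ⟨(⟨i, hij.trans_lt hj⟩, ⟨j, hj⟩), hij⟩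

@[simp] theorem row_mk {i j : ℕ} (hij : i ≤ j) (hj : j < n) : (mk i j hij hj).row = i := rfl

@[simp] theorem col_mk {i j : ℕ} (hij : i ≤ j) (hj : j < n) : (mk i j hij hj).col = j := rfl

theorem ext {p q : ShiftedCell n} (h1 : p.row = q.row) (h2 : p.col = q.col) : p = q :=
  Subtype.ext (Prod.ext (Fin.ext h1) (Fin.ext h2))

theorem row_le_col (p : ShiftedCell n) : p.row ≤ p.col := p.2

theorem col_lt (p : ShiftedCell n) : p.col < n := p.1.2.2

/-- `p` is immediately above or immediately to the left of `q`. -/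
def Precedes (p q : ShiftedCell n) : Prop :=
  (p.row + 1 = q.row ∧ p.col = q.col) ∨ (p.row = q.row ∧ p.col + 1 = q.col)

instance : DecidableRel (Precedes (n := n)) := fun _ _ => instDecidableOr

end ShiftedCell

/-- The cells of the shifted diagram with row lengths `l`. -/
noncomputable def shiftedDiagram (n : ℕ) (l : ℕ → ℕ) : Finset (ShiftedCell n) :=
  Finset.univ.filter fun p => p.col < p.row + l p.row

theorem mem_shiftedDiagram {p : ShiftedCell n} :
    p ∈ shiftedDiagram n l ↔ p.col < p.row + l p.row := by
  simp [shiftedDiagram]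

namespace IsStrictShape

theorem mem_of_precedes (h : IsStrictShape n m l) (p q : ShiftedCell n) (hpq : p.Precedes q)
    (hq : q ∈ shiftedDiagram n l) : p ∈ shiftedDiagram n l := by
  rw [mem_shiftedDiagram] at *
  have := q.row_le_col
  rcases hpq with ⟨h1, h2⟩ | ⟨h1, h2⟩
  · rw [← h1] at hq this
    have := h.le_of_pos (i := p.row + 1) (by omega)
    have := h.lt p.row (by omega)
    rw [h2]
    omega
  · rw [h1]
    omega

theorem nonempty (h : IsStrictShape n m l) : (shiftedDiagram n l).Nonempty := by
  have h0 := h.pos (Nat.zero_le m)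
  have hn : 0 < n := h0.trans_le h.le
  exact ⟨.mk 0 0 le_rfl hn, by simpa [mem_shiftedDiagram] using h0⟩

/-- The maximal cells are the row ends that can be removed. -/
theorem maximal_iff (h : IsStrictShape n m l) {p : ShiftedCell n} :
    (p ∈ shiftedDiagram n l ∧ ∀ q ∈ shiftedDiagram n l, ¬ p.Precedes q) ↔
      p.col + 1 = p.row + l p.row ∧
        (l (p.row + 1) + 1 < l p.row ∨ l p.row = 1) := by
  have hp := p.row_le_col
  constructor
  · rintro ⟨h1, h2⟩
    rw [mem_shiftedDiagram] at h1
    have hm := h.le_of_pos (i := p.row) (by omega)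
    have hle := h.add_le hm
    have hlt := h.lt _ hm
    have hcol : p.col + 1 = p.row + l p.row := by
      by_contra hne
      refine h2 (.mk p.row (p.col + 1) (by omega) (by omega)) ?_ (Or.inr ⟨rfl, rfl⟩)
      rw [mem_shiftedDiagram, ShiftedCell.row_mk, ShiftedCell.col_mk]
      omega
    refine ⟨hcol, ?_⟩
    by_contra hne
    refine h2 (.mk (p.row + 1) p.col (by omega) p.col_lt) ?_ (Or.inl ⟨rfl, rfl⟩)
    rw [mem_shiftedDiagram, ShiftedCell.row_mk, ShiftedCell.col_mk]
    omega
  · rintro ⟨h1, h2⟩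
    refine ⟨by rw [mem_shiftedDiagram]; omega, fun q hq hpq => ?_⟩
    rw [mem_shiftedDiagram] at hq
    have := q.row_le_col
    rcases hpq with ⟨h3, h4⟩ | ⟨h3, h4⟩
    · rw [← h3, ← h4] at hq
      rw [← h3, ← h4] at this
      omega
    · rw [← h3] at hq
      omega

theorem sum_maximal {M : Type*} [AddCommMonoid M] (h : IsStrictShape n m l) (f : ℕ → M) :
    ∑ p ∈ shiftedDiagram n l with ∀ q ∈ shiftedDiagram n l, ¬ p.Precedes q, f p.row =
      ∑ i ∈ Finset.range (m + 1) with l (i + 1) + 1 < l i ∨ l i = 1, f i := by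
  refine Finset.sum_bij (fun p _ => p.row) ?_ ?_ ?_ fun _ _ => rfl
  · intro p hp
    rw [Finset.mem_filter, h.maximal_iff] at hp
    have := h.le_of_pos (i := p.row) (by have := p.row_le_col; omega)
    simpa using ⟨by omega, hp.2⟩
  · intro p hp q hq hpq
    rw [Finset.mem_filter, h.maximal_iff] at hp hq
    refine ShiftedCell.ext hpq ?_
    have := hp.1
    have := hq.1
    rw [← hpq] at this
    omega
  · intro i hi
    simp only [Finset.mem_filter, Finset.mem_range] at hi
    have hle := h.add_le (i := i) (by omega)
    have hpos := h.pos (i := i) (by omega)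
    refine ⟨.mk i (i + l i - 1) (by omega) (by omega), ?_, rfl⟩
    rw [Finset.mem_filter, h.maximal_iff, ShiftedCell.row_mk, ShiftedCell.col_mk]
    exact ⟨by omega, hi.2⟩

end IsStrictShape

theorem erase_shiftedDiagram {p : ShiftedCell n} (hp : p.col + 1 = p.row + l p.row) :
    (shiftedDiagram n l).erase p = shiftedDiagram n (lowerPart l p.row) := by
  ext q
  rw [Finset.mem_erase, mem_shiftedDiagram, mem_shiftedDiagram, lowerPart, Function.update_apply]
  split_ifs with h
  · have : q = p ↔ q.col = p.col := ⟨fun h' => by rw [h'], fun h' => ShiftedCell.ext h h'⟩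
    have := p.row_le_col
    rw [ne_eq, ‹q = p ↔ _›, h]
    omega
  · have : q ≠ p := fun h' => h (by rw [h'])
    simp [this]

/-- The diagonal entry in row `i`, zero outside of the triangle. -/
def diagonal (T : ShiftedCell n → ℕ) (i : ℕ) : ℕ :=
  if h : i < n then T (.mk i i le_rfl h) else 0

theorem diagonal_update_of_ne (T : ShiftedCell n → ℕ) (p : ShiftedCell n) (N : ℕ) {i : ℕ}
    (h : ¬ (p.row = i ∧ p.col = i)) :
    diagonal (Function.update T p N) i = diagonal T i := by
  unfold diagonal
  split_ifs with hi
  · rw [Function.update_of_ne]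
    rintro rfl
    simp at h
  · rfl

theorem diagonal_update_self (T : ShiftedCell n → ℕ) (p : ShiftedCell n) (N : ℕ) {i : ℕ}
    (h1 : p.row = i) (h2 : p.col = i) :
    diagonal (Function.update T p N) i = N := by
  subst h1
  unfold diagonal
  rw [dif_pos (p.row_le_col.trans_lt p.col_lt), show ShiftedCell.mk p.row p.row _ _ = p from
    ShiftedCell.ext rfl h2.symm, Function.update_self]

/-- The weight `∏ t_i ^ a_i / a_i! * X ^ b / b!` of a filling with `N` entries, where the `a_i`
are the gaps between consecutive diagonal entries and `b` counts the entries after the last one. -/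
noncomputable def weight (t : ℕ → ℚ) (m N : ℕ) (T : ShiftedCell n → ℕ) : Polynomial ℚ :=
  Polynomial.C (∏ i ∈ Finset.range m,
      (dividedPow (diagonal T (i + 1) - diagonal T i - 1)).eval (t i)) *
    dividedPow (N - diagonal T m)

/-- The weighted count of the standard fillings of the diagram of `l`. -/
noncomputable def weightSum (n : ℕ) (t : ℕ → ℚ) (m : ℕ) (l : ℕ → ℕ) : Polynomial ℚ :=
  ∑ T ∈ standardFillings ShiftedCell.Precedes (shiftedDiagram n l),
    weight t m (shiftedDiagram n l).card T

theorem diagonal_le {T : ShiftedCell n → ℕ} {S : Finset (ShiftedCell n)}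
    (hT : T ∈ standardFillings ShiftedCell.Precedes S) (i : ℕ) : diagonal T i ≤ S.card := by
  unfold diagonal
  split_ifs
  · exact (mem_standardFillings.1 hT).1 _
  · exact Nat.zero_le _

/-- Adding an off-diagonal cell with the largest entry. -/
theorem weight_update_of_ne (t : ℕ → ℚ) {p : ShiftedCell n} (hp : p.row ≠ p.col)
    {T : ShiftedCell n → ℕ} {N : ℕ} (hT : diagonal T m ≤ N) :
    Polynomial.derivative (weight t m (N + 1) (Function.update T p (N + 1))) = weight t m N T ∧
      (weight t m (N + 1) (Function.update T p (N + 1))).eval 0 = 0 := by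
  have hd : ∀ i, diagonal (Function.update T p (N + 1)) i = diagonal T i := fun i =>
    diagonal_update_of_ne T p (N + 1) (by omega)
  simp only [weight, hd, Nat.sub_add_comm hT]
  constructor
  · rw [Polynomial.derivative_C_mul, derivative_dividedPow_succ]
  · rw [Polynomial.eval_mul, eval_zero_dividedPow (Nat.succ_ne_zero _), mul_zero]

/-- Adding the diagonal cell of the last row with the largest entry. -/
theorem weight_update_diagonal (t : ℕ → ℚ) {p : ShiftedCell n} (h1 : p.row = m + 1)
    (h2 : p.col = m + 1) (T : ShiftedCell n → ℕ) (N : ℕ) :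
    weight t (m + 1) (N + 1) (Function.update T p (N + 1)) =
      Polynomial.C ((weight t m N T).eval (t m)) := by
  have hd : ∀ i ≤ m, diagonal (Function.update T p (N + 1)) i = diagonal T i := fun i hi =>
    diagonal_update_of_ne T p (N + 1) (by omega)
  unfold weight
  rw [diagonal_update_self T p (N + 1) h1 h2, Nat.sub_self, dividedPow_zero, mul_one,
    Finset.prod_range_succ, diagonal_update_self T p (N + 1) h1 h2, hd m le_rfl,
    Polynomial.eval_mul, Polynomial.eval_C]
  congr 2
  · refine Finset.prod_congr rfl fun i hi => ?_
    rw [Finset.mem_range] at hi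
    rw [hd i hi.le, hd (i + 1) hi]
  · congr 2
    omega

theorem weight_of_diagonal_eq (t : ℕ → ℚ) {T : ShiftedCell n → ℕ} {N : ℕ}
    (hT : diagonal T m = N) :
    weight t m N T = Polynomial.C (∏ i ∈ Finset.range m,
      (dividedPow (diagonal T (i + 1) - diagonal T i - 1)).eval (t i)) := by
  rw [weight, hT, Nat.sub_self, dividedPow_zero, mul_one]

theorem weight_update_of_offDiagonal (t : ℕ → ℚ) {p : ShiftedCell n}
    (hp : p ∈ shiftedDiagram n l) (hrow : p.row ≠ p.col) {T : ShiftedCell n → ℕ}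
    (hT : T ∈ standardFillings ShiftedCell.Precedes ((shiftedDiagram n l).erase p)) :
    Polynomial.derivative (weight t m (shiftedDiagram n l).card
        (Function.update T p (shiftedDiagram n l).card)) =
      weight t m ((shiftedDiagram n l).erase p).card T ∧
    (weight t m (shiftedDiagram n l).card
      (Function.update T p (shiftedDiagram n l).card)).eval 0 = 0 := by
  rw [← Finset.card_erase_add_one hp]
  exact weight_update_of_ne t hrow (diagonal_le hT m)

namespace IsStrictShape

/-- A removable cell is either off the diagonal, or the diagonal cell of the last row. -/
theorem maximal_cases (h : IsStrictShape n m l) {p : ShiftedCell n}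
    (hp : p ∈ shiftedDiagram n l ∧ ∀ q ∈ shiftedDiagram n l, ¬ p.Precedes q) :
    (p.row ≠ p.col ∧ l (p.row + 1) + 1 < l p.row ∧ l p.row ≠ 1) ∨
      (p.row = m ∧ p.col = m ∧ l m = 1 ∧ ¬ l (p.row + 1) + 1 < l p.row) := by
  obtain ⟨h1, h2⟩ := h.maximal_iff.1 hp
  rcases h2 with h2 | h2
  · exact Or.inl (by omega)
  · obtain rfl := h.eq_of_eq_one h2
    exact Or.inr (by omega)

theorem card_lowerPart_lt (h : IsStrictShape n m l) {i : ℕ} (hi : i ≤ m) :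
    (shiftedDiagram n (_root_.lowerPart l i)).card < (shiftedDiagram n l).card := by
  have hle := h.add_le hi
  have hpos := h.pos hi
  have herase := erase_shiftedDiagram (l := l)
    (p := (.mk i (i + l i - 1) (by omega) (by omega) : ShiftedCell n))
    (by rw [ShiftedCell.row_mk, ShiftedCell.col_mk]; omega)
  rw [ShiftedCell.row_mk] at herase
  rw [← herase]
  refine Finset.card_erase_lt_of_mem ?_
  rw [mem_shiftedDiagram, ShiftedCell.row_mk, ShiftedCell.col_mk]
  omega

theorem derivative_weightSum (h : IsStrictShape n m l) (t : ℕ → ℚ) :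
    Polynomial.derivative (weightSum n t m l) =
      ∑ i ∈ Finset.range (m + 1),
        if l (i + 1) + 1 < l i then weightSum n t m (_root_.lowerPart l i) else 0 := by
  rw [weightSum, sum_standardFillings h.mem_of_precedes h.nonempty, Polynomial.derivative_sum]
  trans ∑ p ∈ shiftedDiagram n l with ∀ q ∈ shiftedDiagram n l, ¬ p.Precedes q,
    if l (p.row + 1) + 1 < l p.row then weightSum n t m (_root_.lowerPart l p.row) else 0
  · refine Finset.sum_congr rfl fun p hp => ?_
    rw [Finset.mem_filter] at hp
    rw [Polynomial.derivative_sum]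
    rcases h.maximal_cases hp with ⟨h1, h2, -⟩ | ⟨h1, h2, h3, h4⟩
    · rw [if_pos h2, weightSum, ← erase_shiftedDiagram (h.maximal_iff.1 hp).1]
      exact Finset.sum_congr rfl fun T hT => (weight_update_of_offDiagonal t hp.1 h1 hT).1
    · rw [if_neg h4]
      refine Finset.sum_eq_zero fun T _ => ?_
      rw [weight_of_diagonal_eq t (diagonal_update_self T p _ h1 h2), Polynomial.derivative_C]
  · rw [h.sum_maximal fun i => if l (i + 1) + 1 < l i then
      weightSum n t m (_root_.lowerPart l i) else 0, Finset.sum_filter]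
    refine Finset.sum_congr rfl fun i _ => ?_
    split_ifs <;> tauto

theorem eval_zero_weightSum_of_ne (h : IsStrictShape n m l) (t : ℕ → ℚ) (hm : l m ≠ 1) :
    (weightSum n t m l).eval 0 = 0 := by
  rw [weightSum, sum_standardFillings h.mem_of_precedes h.nonempty, Polynomial.eval_finsetSum]
  refine Finset.sum_eq_zero fun p hp => ?_
  rw [Finset.mem_filter] at hp
  rw [Polynomial.eval_finsetSum]
  rcases h.maximal_cases hp with ⟨h1, -⟩ | ⟨-, -, h3, -⟩
  · exact Finset.sum_eq_zero fun T hT => (weight_update_of_offDiagonal t hp.1 h1 hT).2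
  · exact absurd h3 hm

theorem eval_zero_weightSum (h : IsStrictShape n m l) (t : ℕ → ℚ) (hm : l m = 1) :
    ∃ p : ShiftedCell n, p.row = m ∧ p.col = m ∧ p ∈ shiftedDiagram n l ∧
      (weightSum n t m l).eval 0 =
        ∑ T ∈ standardFillings ShiftedCell.Precedes ((shiftedDiagram n l).erase p),
          (weight t m (shiftedDiagram n l).card
            (Function.update T p (shiftedDiagram n l).card)).eval 0 := by
  have hle := h.add_le le_rfl
  set p : ShiftedCell n := .mk m m le_rfl (by omega)
  have hrow : p.row = m := rfl
  have hcol : p.col = m := rfl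
  have hp := (h.maximal_iff (p := p)).2 (by rw [hrow, hcol]; omega)
  refine ⟨p, hrow, hcol, hp.1, ?_⟩
  rw [weightSum, sum_standardFillings h.mem_of_precedes h.nonempty, Polynomial.eval_finsetSum,
    Finset.sum_eq_single_of_mem p (Finset.mem_filter.2 hp), Polynomial.eval_finsetSum]
  intro q hq hqp
  rw [Finset.mem_filter] at hq
  rw [Polynomial.eval_finsetSum]
  rcases h.maximal_cases hq with ⟨h1, -⟩ | ⟨h1, h2, -⟩
  · exact Finset.sum_eq_zero fun T hT => (weight_update_of_offDiagonal t hq.1 h1 hT).2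
  · exact absurd (ShiftedCell.ext (h1.trans hrow.symm) (h2.trans hcol.symm)) hqp

theorem eval_zero_weightSum_zero (h : IsStrictShape n 0 l) (t : ℕ → ℚ) (hm : l 0 = 1) :
    (weightSum n t 0 l).eval 0 = 1 := by
  obtain ⟨p, hrow, hcol, hp, heq⟩ := h.eval_zero_weightSum t hm
  have hempty : (shiftedDiagram n l).erase p = ∅ := by
    refine Finset.eq_empty_of_forall_notMem fun q hq => ?_
    rw [Finset.mem_erase, mem_shiftedDiagram] at hq
    have := q.row_le_col
    have hq0 : q.row = 0 := Nat.le_zero.1 (h.le_of_pos (by omega))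
    rw [hq0, hm] at hq
    exact hq.1 (ShiftedCell.ext (by omega) (by omega))
  rw [heq, hempty, standardFillings_empty, Finset.sum_singleton,
    weight_of_diagonal_eq t (diagonal_update_self _ p _ hrow hcol)]
  simp

theorem eval_zero_weightSum_succ (h : IsStrictShape n (m + 1) l) (t : ℕ → ℚ)
    (hm : l (m + 1) = 1) :
    (weightSum n t (m + 1) l).eval 0 =
      (weightSum n t m (_root_.lowerPart l (m + 1))).eval (t m) := by
  obtain ⟨p, hrow, hcol, hp, heq⟩ := h.eval_zero_weightSum t hm
  have herase := erase_shiftedDiagram (l := l) (p := p) (by rw [hrow, hcol]; omega)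
  rw [hrow] at herase
  rw [heq, weightSum, ← herase, Polynomial.eval_finsetSum]
  refine Finset.sum_congr rfl fun T _ => ?_
  rw [← Finset.card_erase_add_one hp, weight_update_diagonal t hrow hcol, Polynomial.eval_C]

/-- The weighted count of standard fillings of a shifted shape is a determinant. -/
theorem weightSum_eq_det (h : IsStrictShape n m l) (t : ℕ → ℚ) :
    weightSum n t m l = (shapeMatrix t m l).det := by
  induction hN : (shiftedDiagram n l).card using Nat.strong_induction_on generalizing m l with
  | _ N ih =>
    refine polynomial_eq_of_derivative_eq ?_ ?_
    · rw [h.derivative_weightSum, derivative_det_shapeMatrix t h]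
      refine Finset.sum_congr rfl fun i hi => ?_
      split_ifs with h1
      · exact ih _ (hN ▸ h.card_lowerPart_lt (by simpa [Nat.lt_succ_iff] using hi))
          (h.lowerPart h1) rfl
      · rfl
    · by_cases hm : l m = 1
      · cases m with
        | zero =>
          rw [h.eval_zero_weightSum_zero t hm, Matrix.det_fin_one, eval_shapeMatrix]
          simp [hm, dividedPow_zero]
        | succ m =>
          rw [h.eval_zero_weightSum_succ t hm, eval_zero_det_shapeMatrix_succ t h hm,
            ih _ (hN ▸ h.card_lowerPart_lt le_rfl) (h.lowerPart_last hm) rfl]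
      · rw [h.eval_zero_weightSum_of_ne t hm, eval_zero_det_shapeMatrix_of_ne t h hm]

end IsStrictShape

end ShiftedShapes

section Staircase

variable {n : ℕ}

theorem isStrictShape_staircase (n : ℕ) : IsStrictShape (n + 1) n fun i => n + 1 - i where
  lt i hi := by omega
  zero i hi := by omega
  le := le_rfl

theorem shiftedDiagram_staircase (n : ℕ) :
    shiftedDiagram (n + 1) (fun i => n + 1 - i) = Finset.univ := by
  ext p
  have := p.row_le_col
  have := p.col_lt
  simp only [mem_shiftedDiagram, Finset.mem_univ, iff_true]
  omega

theorem prod_Ioi_sub (i : Fin (n + 1)) :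
    ∏ j ∈ Finset.Ioi i, (((j : ℕ) : ℚ) - ((i : ℕ) : ℚ)) = ((n - i).factorial : ℚ) := by
  have h := Finset.prod_map (Finset.Ioi i) Fin.valEmbedding fun j : ℕ => (j : ℚ) - ((i : ℕ) : ℚ)
  rw [Fin.map_valEmbedding_Ioi] at h
  simp only [Fin.valEmbedding_apply] at h
  rw [← h, ← Finset.prod_range_add_one_eq_factorial,
    show Finset.Ioo (i : ℕ) (n + 1) = Finset.Ico (i + 1 : ℕ) (n + 1) by ext; simp,
    Finset.prod_Ico_eq_prod_range, Nat.cast_prod, Nat.add_sub_add_right]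
  refine Finset.prod_congr rfl fun k _ => ?_
  push_cast
  ring

theorem det_shapeMatrix_staircase (t : ℕ → ℚ) :
    (shapeMatrix t n fun i => n + 1 - i).det.eval 0 =
      ∏ i : Fin (n + 1), ∏ j ∈ Finset.Ioi i,
        (((j : ℕ) : ℚ) - ((i : ℕ) : ℚ))⁻¹ * ∑ k ∈ Finset.Ico (i : ℕ) j, t k := by
  set w : Fin (n + 1) → ℚ := fun i => ∑ k ∈ Finset.Ico (i : ℕ) n, t k with hw
  have hmat : (shapeMatrix t n fun i => n + 1 - i).map (Polynomial.eval 0) =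
      Matrix.of fun (i j : Fin (n + 1)) =>
        ((n - j).factorial : ℚ)⁻¹ * Matrix.projVandermonde 1 w i j := by
    ext i j
    rw [Matrix.map_apply, eval_shapeMatrix, eval_dividedPow, Matrix.of_apply,
      Matrix.projVandermonde_apply, Fin.val_rev, Pi.one_apply, one_pow, one_mul, zero_add,
      show n + 1 - (j : ℕ) - 1 = n - j by omega, show n + 1 - ((j : ℕ) + 1) = n - j by omega]
  rw [eval_det_shapeMatrix, hmat,
    Matrix.det_mul_row (fun j : Fin (n + 1) => ((n - j).factorial : ℚ)⁻¹),
    Matrix.det_projVandermonde, ← Finset.prod_mul_distrib]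
  refine Finset.prod_congr rfl fun i _ => ?_
  rw [← prod_Ioi_sub, Finset.prod_mul_distrib, Finset.prod_inv_distrib]
  congr 1
  refine Finset.prod_congr rfl fun j hj => ?_
  have hij : (i : ℕ) ≤ j := (Finset.mem_Ioi.1 hj).le
  simp only [Pi.one_apply, one_mul, hw]
  rw [← Finset.sum_Ico_consecutive _ hij (by omega : (j : ℕ) ≤ n), add_sub_cancel_right]

theorem diagonal_last {T : ShiftedCell (n + 1) → ℕ}
    (hT : T ∈ standardFillings ShiftedCell.Precedes Finset.univ) :
    diagonal T n = (Finset.univ : Finset (ShiftedCell (n + 1))).card := by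
  have h := isStrictShape_staircase n
  rw [← shiftedDiagram_staircase n] at hT ⊢
  obtain ⟨p, hp, hpT⟩ :=
    exists_eq_of_mem_standardFillings hT (Finset.card_pos.2 h.nonempty) le_rfl
  have hmax := (update_zero_mem_standardFillings hp hT hpT).1
  have hn : p.row = n ∧ p.col = n := by
    have := h.maximal_cases ⟨hp, hmax⟩
    have := p.row_le_col
    have := p.col_lt
    omega
  rw [← hpT, ← Function.update_eq_self p T, diagonal_update_self T p _ hn.1 hn.2]
  simp

theorem sum_staircase (t : ℕ → ℚ) :
    ∑ T ∈ standardFillings ShiftedCell.Precedes (Finset.univ : Finset (ShiftedCell (n + 1))),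
      ∏ i ∈ Finset.range n, (dividedPow (diagonal T (i + 1) - diagonal T i - 1)).eval (t i) =
    ∏ i : Fin (n + 1), ∏ j ∈ Finset.Ioi i,
      (((j : ℕ) : ℚ) - ((i : ℕ) : ℚ))⁻¹ * ∑ k ∈ Finset.Ico (i : ℕ) j, t k := by
  rw [← det_shapeMatrix_staircase, ← (isStrictShape_staircase n).weightSum_eq_det, weightSum,
    shiftedDiagram_staircase, Polynomial.eval_finsetSum]
  refine Finset.sum_congr rfl fun T hT => ?_
  rw [weight_of_diagonal_eq t (diagonal_last hT), Polynomial.eval_C]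

theorem card_shiftedCell (n : ℕ) : Fintype.card (ShiftedCell n) = n * (n + 1) / 2 := by
  change Fintype.card {p : Fin n × Fin n // p.1 ≤ p.2} = _
  rw [Fintype.card_subtype, Finset.card_filter, Fintype.sum_prod_type_right]
  have h : ∀ j : Fin n, (∑ i, if i ≤ j then 1 else 0) = (j : ℕ) + 1 := fun j => by
    rw [← Finset.card_filter, ← Fin.card_Iic]
    congr 1
    ext
    simp
  simp only [h]
  rw [← Finset.sum_range fun j => j + 1, mul_comm,
    show (n + 1) * n / 2 = _ from (Finset.sum_range_id (n + 1)).symm,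
    Finset.sum_range_succ', add_zero]

theorem isShiftedSYT_iff {T : ShiftedCell n → ℕ} :
    IsShiftedSYT n T ↔ T ∈ standardFillings ShiftedCell.Precedes Finset.univ := by
  rw [mem_standardFillings, IsShiftedSYT, ← card_shiftedCell, ← Finset.card_univ]
  constructor
  · rintro ⟨hinj, hrange, hcol, hrow⟩
    have hmem : ∀ p, 1 ≤ T p ∧ T p ≤ (Finset.univ : Finset (ShiftedCell n)).card := fun p =>
      Set.mem_Icc.1 (hrange ▸ Set.mem_range_self p)
    refine ⟨fun p => (hmem p).2, fun p => iff_of_true (Finset.mem_univ p) (hmem p).1,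
      hinj.injOn, fun p q hpq _ => ⟨(hmem p).1, ?_⟩⟩
    rcases hpq with ⟨h1, h2⟩ | ⟨h1, h2⟩
    · exact hcol p q ⟨h1, Fin.ext h2⟩
    · exact hrow p q ⟨Fin.ext h1, h2⟩
  · rintro ⟨hle, hpos, hinj, hmono⟩
    refine ⟨Set.injOn_univ.1 (by simpa using hinj), ?_,
      fun p q h => (hmono p q (Or.inl ⟨h.1, congrArg Fin.val h.2⟩) (Finset.mem_univ _)).2,
      fun p q h => (hmono p q (Or.inr ⟨congrArg Fin.val h.1, h.2⟩) (Finset.mem_univ _)).2⟩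
    refine Set.Subset.antisymm ?_ fun k hk => ?_
    · rintro _ ⟨p, rfl⟩
      exact ⟨(hpos p).1 (Finset.mem_univ p), hle p⟩
    · obtain ⟨p, -, hp⟩ := exists_eq_of_mem_standardFillings
        (mem_standardFillings.2 ⟨hle, hpos, hinj, hmono⟩) hk.1 hk.2
      exact ⟨p, hp⟩

theorem diagonal_zero {T : ShiftedCell (n + 1) → ℕ}
    (hT : T ∈ standardFillings ShiftedCell.Precedes Finset.univ) : diagonal T 0 = 1 := by
  have hpos : 0 < (Finset.univ : Finset (ShiftedCell (n + 1))).card :=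
    Finset.card_pos.2 ⟨.mk 0 0 le_rfl n.succ_pos, Finset.mem_univ _⟩
  obtain ⟨p, -, hp⟩ := exists_eq_of_mem_standardFillings hT one_pos hpos
  obtain ⟨-, -, -, hmono⟩ := mem_standardFillings.1 hT
  have hmin : ∀ q, ¬ ShiftedCell.Precedes q p := fun q hq => by
    have := hmono q p hq (Finset.mem_univ _)
    omega
  have hrc := p.row_le_col
  have hlt := p.col_lt
  have hrow : p.row = 0 := by
    by_contra h
    exact hmin (.mk (p.row - 1) p.col (by omega) hlt)
      (Or.inl ⟨by rw [ShiftedCell.row_mk]; omega, rfl⟩)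
  have hcol : p.col = 0 := by
    by_contra h
    exact hmin (.mk p.row (p.col - 1) (by omega) (by omega))
      (Or.inr ⟨rfl, by rw [ShiftedCell.col_mk]; omega⟩)
  rw [← Function.update_eq_self p T, diagonal_update_self T p _ hrow hcol, hp]

theorem diagonal_lt_succ {T : ShiftedCell (n + 1) → ℕ}
    (hT : T ∈ standardFillings ShiftedCell.Precedes Finset.univ) {i : ℕ} (hi : i < n) :
    diagonal T i < diagonal T (i + 1) := by
  obtain ⟨-, -, -, hmono⟩ := mem_standardFillings.1 hT
  rw [diagonal, diagonal, dif_pos (by omega), dif_pos (by omega)]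
  have h1 := hmono (.mk i i le_rfl (by omega)) (.mk i (i + 1) (by omega) (by omega))
    (Or.inr ⟨rfl, rfl⟩) (Finset.mem_univ _)
  have h2 := hmono (.mk i (i + 1) (by omega) (by omega)) (.mk (i + 1) (i + 1) le_rfl (by omega))
    (Or.inl ⟨rfl, rfl⟩) (Finset.mem_univ _)
  exact h1.2.trans h2.2

/-- The gaps between consecutive diagonal entries. -/
def diagonalGaps (n : ℕ) (T : ShiftedCell (n + 1) → ℕ) (i : Fin n) : ℕ :=
  diagonal T (i + 1) - diagonal T i - 1

theorem diagEntry_eq_diagonal (T : ShiftedCell n → ℕ) (i : Fin n) :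
    diagEntry n T i = diagonal T i := by
  rw [diagonal, dif_pos i.2]
  rfl

theorem Ntab_eq_card (n : ℕ) (a : Fin n → ℕ) :
    Ntab n a = ((standardFillings ShiftedCell.Precedes Finset.univ).filter
      fun T => diagonalGaps n T = a).card := by
  rw [Ntab, ← Set.ncard_coe_finset]
  congr 1
  ext T
  simp only [Set.mem_ofPred_eq, Finset.coe_filter, isShiftedSYT_iff, diagEntry_eq_diagonal,
    funext_iff, diagonalGaps, Fin.val_succ, Fin.val_castSucc, Fin.val_zero]
  refine and_congr_right fun hT => ?_
  rw [and_iff_right (diagonal_zero hT)]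
  refine forall_congr' fun i => ?_
  have := diagonal_lt_succ hT i.2
  omega

end Staircase

theorem stmt15 (n : ℕ) :
    {a : Fin n → ℕ | Ntab n a ≠ 0}.Finite ∧
    (∑ᶠ a : Fin n → ℕ,
        (C ((Ntab n a : ℚ) / ∏ i, (Nat.factorial (a i) : ℚ)) *
          ∏ i, X i ^ a i : MvPolynomial (Fin n) ℚ)) =
      ∏ p ∈ Finset.univ.filter (fun p : Fin (n + 1) × Fin (n + 1) => p.1 < p.2),
        (C ((((p.2 : ℕ) : ℚ) - ((p.1 : ℕ) : ℚ))⁻¹) *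
          ∑ k : Fin n, if (p.1 : ℕ) ≤ (k : ℕ) ∧ (k : ℕ) < (p.2 : ℕ) then X k else 0) := by
  classical
  set F := standardFillings ShiftedCell.Precedes (Finset.univ : Finset (ShiftedCell (n + 1)))
  have hN : ∀ a, Ntab n a ≠ 0 → a ∈ F.image (diagonalGaps n) := fun a ha => by
    rw [Ntab_eq_card, Finset.card_ne_zero] at ha
    obtain ⟨T, hT⟩ := ha
    rw [Finset.mem_filter] at hT
    exact Finset.mem_image.2 ⟨T, hT⟩
  refine ⟨(F.image (diagonalGaps n)).finite_toSet.subset hN, ?_⟩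
  rw [finsum_eq_sum_of_support_subset (s := F.image (diagonalGaps n))]
  · refine MvPolynomial.funext fun x => ?_
    set t : ℕ → ℚ := fun k => if h : k < n then x ⟨k, h⟩ else 0 with ht
    have htx : ∀ k : Fin n, t k = x k := fun k => by simp [ht]
    trans ∑ T ∈ F, ∏ i ∈ Finset.range n,
      (dividedPow (diagonal T (i + 1) - diagonal T i - 1)).eval (t i)
    · rw [← Finset.sum_fiberwise_of_maps_to (g := diagonalGaps n)
        fun T hT => Finset.mem_image_of_mem _ hT, map_sum]
      refine Finset.sum_congr rfl fun a _ => ?_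
      rw [Finset.sum_congr rfl (g := fun _ => ∏ i, ((a i).factorial : ℚ)⁻¹ * x i ^ a i),
        Finset.sum_const, Ntab_eq_card]
      · simp [Finset.prod_mul_distrib, div_eq_mul_inv, mul_assoc, F]
      · intro T hT
        rw [Finset.prod_range]
        refine Finset.prod_congr rfl fun i _ => ?_
        rw [eval_dividedPow, htx, ← (Finset.mem_filter.1 hT).2]
        rfl
    · rw [sum_staircase, Finset.prod_filter, Fintype.prod_prod_type, map_prod]
      refine Finset.prod_congr rfl fun i _ => ?_
      rw [map_prod, ← Finset.filter_lt_eq_Ioi, Finset.prod_filter]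
      refine Finset.prod_congr rfl fun j _ => ?_
      split_ifs with hij
      · have hsum : ∑ k ∈ Finset.Ico (i : ℕ) j, t k =
            ∑ k : Fin n, if (i : ℕ) ≤ k ∧ (k : ℕ) < j then x k else 0 := by
          simp only [← htx]
          rw [← Finset.sum_range fun k => if (i : ℕ) ≤ k ∧ k < j then t k else 0,
            ← Finset.sum_filter]
          refine Finset.sum_congr ?_ fun _ _ => rfl
          ext k
          simp only [Finset.mem_Ico, Finset.mem_filter, Finset.mem_range]
          omega
        rw [hsum, map_mul, eval_C, map_sum]
        simp only [apply_ite (eval x), eval_X, map_zero]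
      · simp
  · intro a ha
    refine hN a fun h => ha ?_
    simp [h]
end

section
/- Let n ≥ 1 and let u_1,…,u_{n+1} be nonnegative real numbers. Define V̂(u_1,…,u_{n+1}) := Vol P_{n+1}(x_1,…,x_{n+1}), where x_k := u_k + u_{k+1} + ⋯ + u_n for 1 ≤ k ≤ n and x_{n+1} := 0 (so V̂ does not depend on its last argument). Then the sum of V̂ over all n+1 cyclic shifts of its arguments equals (u_1 + ⋯ + u_{n+1})^n; that is, V̂(u_1,…,u_{n+1}) + V̂(u_{n+1}, u_1, …, u_n) + ⋯ + V̂(u_2, …, u_{n+1}, u_1) = (u_1 + ⋯ + u_{n+1})^n. -/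
open MeasureTheory

/-- The permutohedron `P_m(x_1,…,x_m)`. -/
def permutohedron (m : ℕ) (x : Fin m → ℝ) : Set (Fin m → ℝ) :=
  convexHull ℝ {p | ∃ w : Equiv.Perm (Fin m), p = fun i => x (w i)}

/-- `V̂(u_1,…,u_{n+1}) = Vol P_{n+1}(x_1,…,x_{n+1})` where `x_k = u_k + ⋯ + u_n` for
`1 ≤ k ≤ n` and `x_{n+1} = 0` (here `0`-indexed: `x k = Σ_{k ≤ j < n} u j`). -/
noncomputable def Vhat (n : ℕ) (u : Fin (n + 1) → ℝ) : ℝ :=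
  projVol n (permutohedron (n + 1)
    (fun k : Fin (n + 1) =>
      ∑ j : Fin (n + 1), if (k : ℕ) ≤ (j : ℕ) ∧ (j : ℕ) < n then u j else 0))

/-- The sum of an antitone sequence over a finset is at most the sum of the leading terms. -/
lemma Antitone.sum_le_sum_range_card {f : ℕ → ℝ} (hf : Antitone f) (T : Finset ℕ) :
    ∑ i ∈ T, f i ≤ ∑ i ∈ Finset.range T.card, f i := by
  induction T using Finset.induction_on_max with
  | empty => simp
  | insert a s h ih =>
    have ha : a ∉ s := fun h' => lt_irrefl _ (h a h')
    have hc : s.card ≤ a := by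
      simpa using Finset.card_le_card (fun x hx => Finset.mem_range.2 (h x hx) : s ⊆ Finset.range a)
    rw [Finset.sum_insert ha, Finset.card_insert_of_notMem ha, Finset.sum_range_succ]
    linarith [hf hc]

/-- Abel summation: an antitone weighting of a sequence with nonpositive partial sums. -/
lemma sum_mul_le_of_partial_sums_nonpos (c d : ℕ → ℝ) (m : ℕ)
    (hc : ∀ i < m, c (i + 1) ≤ c i)
    (hd : ∀ k ≤ m, ∑ i ∈ Finset.range k, d i ≤ 0) :
    ∑ i ∈ Finset.range (m + 1), c i * d i ≤ c m * ∑ i ∈ Finset.range (m + 1), d i := by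
  induction m with
  | zero => simp
  | succ m ih =>
    rw [Finset.sum_range_succ, Finset.sum_range_succ _ (m + 1), mul_add]
    have h1 := ih (fun i hi => hc i (by omega)) (fun k hk => hd k (by omega))
    have h2 := mul_le_mul_of_nonpos_right (hc m (by omega)) (hd (m + 1) le_rfl)
    linarith

lemma isCompact_permutohedron {m : ℕ} (x : Fin m → ℝ) : IsCompact (permutohedron m x) := by
  refine Set.Finite.isCompact_convexHull ℝ ((Set.finite_range
    fun (w : Equiv.Perm (Fin m)) i => x (w i)).subset ?_)
  rintro p ⟨w, rfl⟩
  exact ⟨w, rfl⟩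

/-- Rado's theorem: the permutohedron is cut out by the majorization inequalities. -/
lemma mem_permutohedron_iff (n : ℕ) {X : ℕ → ℝ} (hX : Antitone X) (z : Fin (n + 1) → ℝ) :
    z ∈ permutohedron (n + 1) (fun i => X i) ↔
      ∑ i, z i = ∑ k ∈ Finset.range (n + 1), X k ∧
      ∀ S : Finset (Fin (n + 1)), ∑ i ∈ S, z i ≤ ∑ k ∈ Finset.range S.card, X k := by
  constructor
  · intro hz
    let C : Set (Fin (n + 1) → ℝ) := {z | ∑ i, z i = ∑ k ∈ Finset.range (n + 1), X k ∧
      ∀ S : Finset (Fin (n + 1)), ∑ i ∈ S, z i ≤ ∑ k ∈ Finset.range S.card, X k}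
    have hC : Convex ℝ C := by
      intro p hp q hq a b ha hb hab
      refine ⟨?_, fun S => ?_⟩
      · simp only [Pi.add_apply, Pi.smul_apply, smul_eq_mul, Finset.sum_add_distrib,
          ← Finset.mul_sum, hp.1, hq.1]
        rw [← add_mul, hab, one_mul]
      · simp only [Pi.add_apply, Pi.smul_apply, smul_eq_mul, Finset.sum_add_distrib,
          ← Finset.mul_sum]
        calc _ ≤ a * ∑ k ∈ Finset.range S.card, X k + b * ∑ k ∈ Finset.range S.card, X k := by
              gcongr
              · exact hp.2 S
              · exact hq.2 S
          _ = _ := by rw [← add_mul, hab, one_mul]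
    refine convexHull_min ?_ hC hz
    rintro p ⟨w, rfl⟩
    refine ⟨?_, fun S => ?_⟩
    · rw [Equiv.sum_comp w (fun i => X i), Fin.sum_univ_eq_sum_range]
    · have hinj : Function.Injective fun i => ((w i : Fin (n + 1)) : ℕ) :=
        Fin.val_injective.comp w.injective
      have := hX.sum_le_sum_range_card (S.map ⟨_, hinj⟩)
      simpa using this
  · rintro ⟨hsum, hz⟩
    by_contra hmem
    obtain ⟨f, t, hf, hft⟩ := geometric_hahn_banach_closed_point (convex_convexHull ℝ _)
      (isCompact_permutohedron fun i => X i).isClosed hmem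
    obtain ⟨c, hc⟩ : ∃ c : Fin (n + 1) → ℝ, ∀ p, f p = ∑ i, c i * p i :=
      ⟨fun i => f fun j => if i = j then 1 else 0, fun p => by
        simpa [mul_comm] using LinearMap.pi_apply_eq_sum_univ f.toLinearMap p⟩
    let σ := Tuple.sort fun i => -c i
    have hσ : Antitone (c ∘ σ) := fun i j hij =>
      neg_le_neg_iff.1 (Tuple.monotone_sort (fun i => -c i) hij)
    have h1 := hf (fun i => X (σ.symm i)) (subset_convexHull ℝ _ ⟨σ.symm, rfl⟩)
    have key := sum_mul_le_of_partial_sums_nonpos (fun i => c (σ (Fin.ofNat (n + 1) i)))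
      (fun i => z (σ (Fin.ofNat (n + 1) i)) - X i) n ?_ ?_
    · have e1 : ∑ i ∈ Finset.range (n + 1), (z (σ (Fin.ofNat (n + 1) i)) - X i) = 0 := by
        rw [Finset.sum_sub_distrib, ← hsum,
          ← Fin.sum_univ_eq_sum_range (fun i => z (σ (Fin.ofNat (n + 1) i)))]
        simp [Equiv.sum_comp σ z]
      rw [e1, mul_zero,
        ← Fin.sum_univ_eq_sum_range (fun i => c (σ (Fin.ofNat (n + 1) i)) *
          (z (σ (Fin.ofNat (n + 1) i)) - X i))] at key
      simp only [Fin.ofNat_eq_cast, Fin.cast_val_eq_self, mul_sub, Finset.sum_sub_distrib] at key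
      rw [hc, ← Equiv.sum_comp σ] at h1
      rw [hc, ← Equiv.sum_comp σ] at hft
      simp only [Equiv.symm_apply_apply] at h1
      linarith
    · intro i hi
      refine hσ ?_
      rw [Fin.le_def]
      simp only [Fin.ofNat, Nat.mod_eq_of_lt (show i < n + 1 by omega),
        Nat.mod_eq_of_lt (show i + 1 < n + 1 by omega)]
      omega
    · intro k hk
      have hinj : Set.InjOn (fun i => σ (Fin.ofNat (n + 1) i)) (Finset.range k : Set ℕ) := by
        intro i hi j hj hij
        have hi' : i < k := by simpa using hi
        have hj' : j < k := by simpa using hj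
        have := congrArg Fin.val (σ.injective hij)
        simpa [Fin.ofNat, Nat.mod_eq_of_lt (show i < n + 1 by omega),
          Nat.mod_eq_of_lt (show j < n + 1 by omega)] using this
      have := hz ((Finset.range k).image fun i => σ (Fin.ofNat (n + 1) i))
      rw [Finset.sum_image hinj, Finset.card_image_of_injOn hinj, Finset.card_range] at this
      rw [Finset.sum_sub_distrib]
      linarith

/-- Every function on `ℤ` has a discrete antiderivative. -/
lemma exists_int_antidifference (f : ℤ → ℝ) : ∃ F : ℤ → ℝ, F 0 = 0 ∧ ∀ m, F (m + 1) = F m + f m := by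
  refine ⟨fun m => ∑ i ∈ Finset.range m.toNat, f i -
    ∑ i ∈ Finset.range (-m).toNat, f (-(i + 1 : ℤ)), by simp, fun m => ?_⟩
  rcases le_or_gt 0 m with hm | hm
  · obtain ⟨k, rfl⟩ := Int.eq_ofNat_of_zero_le hm
    have h1 : ((k : ℤ) + 1).toNat = k + 1 := by omega
    have h2 : (-((k : ℤ) + 1)).toNat = 0 := by omega
    simp only [h1, h2, Int.toNat_natCast, Int.toNat_neg_natCast, Finset.sum_range_succ,
      Finset.range_zero, Finset.sum_empty]
    ring
  · obtain ⟨k, rfl⟩ : ∃ k : ℕ, m = -(k + 1 : ℤ) := ⟨(-m - 1).toNat, by omega⟩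
    have h1 : (-(k + 1 : ℤ) + 1).toNat = 0 := by omega
    have h2 : (-(-(k + 1 : ℤ) + 1)).toNat = k := by omega
    have h3 : (-(-(k + 1 : ℤ))).toNat = k + 1 := by omega
    have h4 : (-(k + 1 : ℤ)).toNat = 0 := by omega
    simp only [h1, h2, h3, h4, Finset.sum_range_succ, Finset.range_zero, Finset.sum_empty]
    ring

/-- A function on `ℤ` with constant increments is affine. -/
lemma int_affine_of_step {D : ℤ → ℝ} {s : ℝ} (h : ∀ m, D (m + 1) = D m + s) (m : ℤ) :
    D m = D 0 + s * m := by
  induction m using Int.induction_on with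
  | zero => simp
  | succ i ih => rw [h, ih]; push_cast; ring
  | pred i ih =>
    have := h (-i - 1)
    rw [sub_add_cancel, ih] at this
    push_cast at this ⊢
    linarith

lemma sum_range_of_step {F f : ℤ → ℝ} (h : ∀ m, F (m + 1) = F m + f m) (r : ℤ) (k : ℕ) :
    ∑ j ∈ Finset.range k, f (r + j) = F (r + k) - F r := by
  induction k with
  | zero => simp
  | succ k ih =>
    rw [Finset.sum_range_succ, ih, Nat.cast_succ, ← add_assoc, h]
    ring

section QuasiPeriodic

variable {N : ℕ} {U : ℤ → ℝ} {s : ℝ}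

lemma shift_mul_period (hper : ∀ m, U (m + N) = U m + s) (m t : ℤ) :
    U (m + t * N) = U m + s * t := by
  have := int_affine_of_step (D := fun t => U (m + t * N)) (s := s) (fun t => by
    rw [← hper]; congr 1; ring) t
  simpa using this

lemma sum_period (hper : ∀ m, U (m + N) = U m + s) (r : ℤ) :
    ∑ j ∈ Finset.range N, U (r + j) = ∑ j ∈ Finset.range N, U j + s * r := by
  have := int_affine_of_step (D := fun r => ∑ j ∈ Finset.range N, U (r + j)) (s := s) (fun m => by
    have h1 := Finset.sum_range_succ (fun j : ℕ => U (m + j)) N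
    have h2 := Finset.sum_range_succ' (fun j : ℕ => U (m + j)) N
    rw [h1] at h2
    have h3 : ∀ j : ℕ, U (m + 1 + j) = U (m + (j + 1 : ℕ)) := fun j => by
      congr 1; push_cast; ring
    simp only [h3]
    rw [hper] at h2
    simp only [Nat.cast_zero, add_zero] at h2
    linarith) r
  simpa using this

/-- The tiles cover the hyperplane. -/
lemma exists_tile (hN : 0 < N) (hper : ∀ m, U (m + N) = U m + s) (hs : 0 < s)
    (y : Fin N → ℝ) (hy : ∑ i, y i = ∑ j ∈ Finset.range N, U j) :
    ∃ a : Fin N → ℤ, 0 ≤ ∑ i, a i ∧ ∑ i, a i < N ∧ ∀ S : Finset (Fin N),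
      ∑ j ∈ Finset.range S.card, U (∑ i, a i + j) ≤ ∑ i ∈ S, (y i + s * a i) := by
  obtain ⟨G, hG0, hG⟩ := exists_int_antidifference U
  let ψ : (Fin N → ℤ) → ℝ := fun a =>
    G (∑ i, a i) - ∑ i, (y i * a i + s * (a i * (a i - 1) / 2))
  have step (a : Fin N → ℤ) (S : Finset (Fin N)) :
      ψ (fun i => a i + if i ∈ S then 1 else 0) - ψ a =
        ∑ j ∈ Finset.range S.card, U (∑ i, a i + j) - ∑ i ∈ S, (y i + s * a i) := by
    rw [sum_range_of_step hG]
    have h1 : ∑ i, (a i + if i ∈ S then (1 : ℤ) else 0) = ∑ i, a i + S.card := by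
      simp [Finset.sum_add_distrib]
    have h2 : ∑ i ∈ S, (y i + s * a i) = ∑ i, if i ∈ S then y i + s * a i else 0 := by
      simp
    simp only [ψ]
    rw [h1, h2, sub_sub_sub_comm, ← Finset.sum_sub_distrib]
    congr 1
    refine Finset.sum_congr rfl fun i _ => ?_
    split_ifs
    · push_cast; ring
    · push_cast; ring
  have inv1 (a : Fin N → ℤ) : ψ (fun i => a i + 1) = ψ a := by
    have := step a Finset.univ
    simp only [Finset.mem_univ, if_true, Finset.card_univ, Fintype.card_fin] at this
    rw [sum_period hper, Finset.sum_add_distrib, ← Finset.mul_sum, hy] at this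
    push_cast at this
    linarith
  have inv (a : Fin N → ℤ) (t : ℤ) : ψ (fun i => a i + t) = ψ a := by
    have := int_affine_of_step (D := fun t => ψ (fun i => a i + t)) (s := 0) (fun t => by
      rw [add_zero, ← inv1 fun i => a i + t]; congr 1; ext i; ring) t
    simpa using this
  have rep (a : Fin N → ℤ) : ∃ b : Fin N → ℤ, 0 ≤ ∑ i, b i ∧ ∑ i, b i < N ∧ ψ b = ψ a := by
    refine ⟨fun i => a i + -((∑ i, a i) / N), ?_, ?_, inv a _⟩ <;>
    · have := Int.emod_add_mul_ediv (∑ i, a i) N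
      have := Int.emod_nonneg (∑ i, a i) (show (N : ℤ) ≠ 0 by omega)
      have := Int.emod_lt_of_pos (∑ i, a i) (show (0 : ℤ) < N by omega)
      simp only [Finset.sum_add_distrib, Finset.sum_const, Finset.card_univ, Fintype.card_fin,
        nsmul_eq_mul, mul_neg]
      linarith
  let K : Set (Fin N → ℤ) := {a | 0 ≤ ∑ i, a i ∧ ∑ i, a i < N ∧ ψ 0 ≤ ψ a}
  have hK : K.Finite := by
    obtain ⟨B, hB⟩ : ∃ B, ∀ r ∈ Set.Ico (0 : ℤ) N, G r ≤ B :=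
      ((Set.finite_Ico (0 : ℤ) N).image G).bddAbove.imp fun B hB r hr =>
        hB (Set.mem_image_of_mem _ hr)
    let M := (B + ∑ i, (y i - s / 2) ^ 2 / s) * (4 / s)
    refine (Set.finite_Icc (fun _ => -⌈M⌉) (fun _ => ⌈M⌉)).subset ?_
    rintro a ⟨h0, h1, h2⟩
    have hquad : ∑ i, (s / 4 * (a i : ℝ) ^ 2 - (y i - s / 2) ^ 2 / s) ≤ B := by
      calc _ ≤ ∑ i, (y i * a i + s * (a i * (a i - 1) / 2)) := by
            refine Finset.sum_le_sum fun i _ => ?_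
            have : 0 ≤ (s / 2 * a i + (y i - s / 2)) ^ 2 / s := by positivity
            have e : (s / 2 * a i + (y i - s / 2)) ^ 2 / s =
              s / 4 * (a i : ℝ) ^ 2 + (y i - s / 2) * a i + (y i - s / 2) ^ 2 / s := by
              field_simp; ring
            linarith
        _ ≤ B := by
            have := hB _ ⟨h0, h1⟩
            simp only [ψ, Pi.zero_apply, Finset.sum_const_zero, hG0, Int.cast_zero, mul_zero,
              zero_mul, zero_div, add_zero, sub_zero] at h2
            linarith
    rw [Finset.sum_sub_distrib, ← Finset.mul_sum] at hquad
    have hsq : ∑ i, (a i : ℝ) ^ 2 ≤ M := by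
      have : s / 4 * ∑ i, (a i : ℝ) ^ 2 * (4 / s) = ∑ i, (a i : ℝ) ^ 2 := by
        rw [← Finset.sum_mul]; field_simp
      rw [← this, ← Finset.sum_mul, ← mul_assoc]
      exact mul_le_mul_of_nonneg_right (by linarith) (by positivity)
    have hi (i) : |a i| ≤ ⌈M⌉ := by
      have h3 : (a i : ℝ) ^ 2 ≤ M :=
        (Finset.single_le_sum (f := fun i => (a i : ℝ) ^ 2) (fun j _ => sq_nonneg _)
          (Finset.mem_univ i)).trans hsq
      have h4 : a i ^ 2 ≤ ⌈M⌉ := by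
        have := h3.trans (Int.le_ceil M)
        exact_mod_cast this
      have h5 : |a i| ≤ |a i| ^ 2 := by
        rcases (abs_nonneg (a i)).eq_or_lt with h | h
        · simp [← h]
        · nlinarith
      rw [sq_abs] at h5
      exact h5.trans h4
    exact ⟨fun i => (abs_le.1 (hi i)).1, fun i => (abs_le.1 (hi i)).2⟩
  obtain ⟨a, ⟨ha0, ha1, ha2⟩, hmax⟩ := Set.exists_max_image K ψ hK
    ⟨0, by simp, by simpa using hN, le_rfl⟩
  refine ⟨a, ha0, ha1, fun S => ?_⟩
  obtain ⟨b, hb0, hb1, hb⟩ := rep (fun i => a i + if i ∈ S then 1 else 0)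
  have hle : ψ b ≤ ψ a := by
    rcases le_total (ψ 0) (ψ b) with h | h
    · exact hmax b ⟨hb0, hb1, h⟩
    · exact h.trans ha2
  have := step a S
  linarith

/-- Distinct tiles meet only on facet hyperplanes of the first tile. -/
lemma eq_of_mem_two_tiles (hU : Monotone U) (hper : ∀ m, U (m + N) = U m + s)
    (y : Fin N → ℝ) (hy : ∑ i, y i = ∑ j ∈ Finset.range N, U j) (a b : Fin N → ℤ)
    (ha0 : 0 ≤ ∑ i, a i) (ha1 : ∑ i, a i < N) (hb0 : 0 ≤ ∑ i, b i) (hb1 : ∑ i, b i < N)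
    (hab : a ≠ b)
    (ha : ∀ S : Finset (Fin N),
      ∑ j ∈ Finset.range S.card, U (∑ i, a i + j) ≤ ∑ i ∈ S, (y i + s * a i))
    (hb : ∀ S : Finset (Fin N),
      ∑ j ∈ Finset.range S.card, U (∑ i, b i + j) ≤ ∑ i ∈ S, (y i + s * b i)) :
    ∃ S : Finset (Fin N), S.Nonempty ∧ Sᶜ.Nonempty ∧
      ∑ i ∈ S, y i = ∑ j ∈ Finset.range S.card, U (∑ i, a i + j) - s * ∑ i ∈ S, (a i : ℝ) := by
  have hne : Nonempty (Fin N) := by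
    by_contra h
    rw [not_nonempty_iff] at h
    exact hab (Subsingleton.elim _ _)
  obtain ⟨i₀, hi₀⟩ := Finite.exists_max (fun i => b i - a i)
  set m := b i₀ - a i₀ with hm
  let S := Finset.univ.filter fun i => b i - a i = m
  have hS : ∀ i ∈ S, b i - a i = m := fun i hi => (Finset.mem_filter.1 hi).2
  have hSc : ∀ i ∈ Sᶜ, b i - a i ≤ m - 1 := fun i hi => by
    have h1 : b i - a i ≠ m := fun h => Finset.mem_compl.1 hi (by simp [S, h])
    have := hi₀ i
    omega
  have hScne : Sᶜ.Nonempty := by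
    by_contra h
    rw [Finset.not_nonempty_iff_eq_empty, Finset.compl_eq_empty_iff] at h
    have hd : ∀ i, b i = a i + m := fun i => by
      have := hS i (h ▸ Finset.mem_univ i)
      omega
    have hsum : ∑ i, b i = ∑ i, a i + N * m := by
      simp [hd, Finset.sum_add_distrib]
    have hm0 : m = 0 := by nlinarith
    exact hab (funext fun i => by rw [hd, hm0, add_zero])
  refine ⟨S, ⟨i₀, by simp [S, m]⟩, hScne, le_antisymm ?_ ?_⟩
  · have hcard : Sᶜ.card + S.card = N := by simp
    have hD : ∑ i, b i - S.card ≤ ∑ i, a i + (m - 1) * N := by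
      have h1 := Finset.sum_add_sum_compl S (fun i => b i - a i)
      have h0 : ∑ i, (b i - a i) = ∑ i, b i - ∑ i, a i := Finset.sum_sub_distrib _ _
      have h2 : ∑ i ∈ S, (b i - a i) = S.card * m := by
        rw [Finset.sum_congr rfl hS]; simp
      have h3 : ∑ i ∈ Sᶜ, (b i - a i) ≤ Sᶜ.card * (m - 1) := by
        simpa using Finset.sum_le_card_nsmul _ _ _ hSc
      have h4 : (Sᶜ.card : ℤ) + S.card = N := by exact_mod_cast hcard
      rw [← h4]
      linear_combination h3 + h2 - h0 - h1
    have h1 := hb Sᶜ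
    have h2 := Finset.sum_add_sum_compl S (fun i => y i + s * b i)
    have h3 : ∑ i, (y i + s * (b i : ℝ)) = ∑ j ∈ Finset.range N, U (∑ i, b i + j) := by
      rw [sum_period hper, Finset.sum_add_distrib, ← Finset.mul_sum, hy]
      push_cast; rfl
    have h4 : ∑ j ∈ Finset.range N, U (∑ i, b i + j) =
        ∑ j ∈ Finset.range Sᶜ.card, U (∑ i, b i + j) +
        ∑ j ∈ Finset.range S.card, U (∑ i, b i - S.card + j + N) := by
      have e : Finset.range N = Finset.range (Sᶜ.card + S.card) := by rw [hcard]
      rw [e, Finset.sum_range_add]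
      congr 1
      refine Finset.sum_congr rfl fun j _ => ?_
      congr 1
      have : (Sᶜ.card : ℤ) + S.card = N := by exact_mod_cast hcard
      rw [← this]
      push_cast; ring
    have h5 : ∑ j ∈ Finset.range S.card, U (∑ i, b i - S.card + j + N) ≤
        ∑ j ∈ Finset.range S.card, (U (∑ i, a i + j) + s * m) := by
      refine Finset.sum_le_sum fun j _ => ?_
      rw [hper]
      have := hU (show ∑ i, b i - S.card + j ≤ ∑ i, a i + j + (m - 1) * N by linarith)
      rw [shift_mul_period hper] at this
      push_cast at this
      linarith
    have h6 : ∑ i ∈ S, (y i + s * b i) =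
        ∑ i ∈ S, y i + s * ∑ i ∈ S, (a i : ℝ) + S.card * (s * m) := by
      rw [Finset.mul_sum, ← Finset.sum_add_distrib, ← nsmul_eq_mul, ← Finset.sum_const,
        ← Finset.sum_add_distrib]
      refine Finset.sum_congr rfl fun i hi => ?_
      have : (b i : ℝ) = a i + m := by
        have := hS i hi
        rw [← this]; push_cast; ring
      rw [this]; ring
    rw [Finset.sum_add_distrib, Finset.sum_const, nsmul_eq_mul, Finset.card_range] at h5
    linarith
  · have := ha S
    rw [Finset.sum_add_distrib, ← Finset.mul_sum] at this
    linarith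

end QuasiPeriodic

/-- If the translates of finitely many sets by the lattice `s ℤⁿ` tile the space up to null sets,
their volumes add up to the covolume. -/
lemma sum_volume_of_tiling {ι : Type*} [Fintype ι] {n : ℕ} {s : ℝ} (hs : 0 < s)
    (A : ι → Set (Fin n → ℝ)) (hA : ∀ r, MeasurableSet (A r))
    (hcover : ∀ y : Fin n → ℝ, ∃ (r : ι) (q : Fin n → ℤ), (y + fun i => s * q i) ∈ A r)
    (hdisj : ∀ (r r' : ι) (q q' : Fin n → ℤ), (r, q) ≠ (r', q') →
      volume {y : Fin n → ℝ | (y + fun i => s * q i) ∈ A r ∧ (y + fun i => s * q' i) ∈ A r'} = 0) :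
    ∑ r, volume (A r) = ENNReal.ofReal (s ^ n) := by
  let B : Set (Fin n → ℝ) := Set.univ.pi fun _ => Set.Ico 0 s
  have hB : MeasurableSet B := MeasurableSet.univ_pi fun _ => measurableSet_Ico
  have hvB : volume B = ENNReal.ofReal (s ^ n) := by
    rw [Real.volume_pi_Ico]
    simp [ENNReal.ofReal_pow hs.le]
  let v : (Fin n → ℤ) → Fin n → ℝ := fun q i => s * q i
  let T : ι × (Fin n → ℤ) → Set (Fin n → ℝ) := fun p => (fun y => y + v p.2) ⁻¹' A p.1
  have hT : ∀ p, MeasurableSet (T p) := fun p => measurable_add_const _ (hA p.1)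
  have h1 : volume B = ∑' p, volume (B ∩ T p) := by
    rw [← measure_iUnion₀ (μ := volume) (f := fun p => B ∩ T p) ?_
      fun p => (hB.inter (hT p)).nullMeasurableSet]
    · rw [← Set.inter_iUnion, Set.inter_eq_left.2]
      intro y _
      obtain ⟨r, q, h⟩ := hcover y
      exact Set.mem_iUnion.2 ⟨(r, q), h⟩
    · intro p p' hp
      exact measure_mono_null (fun y hy => And.intro hy.1.2 hy.2.2) (hdisj p.1 p'.1 p.2 p'.2 hp)
  have h2 (r : ι) : ∑' q, volume (B ∩ T (r, q)) = volume (A r) := by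
    have h3 (q) : volume (B ∩ T (r, q)) = volume ({z | z - v q ∈ B} ∩ A r) := by
      rw [← measure_preimage_add_right volume (v q) ({z | z - v q ∈ B} ∩ A r)]
      congr 1
      ext y
      simp [T]
    simp only [h3]
    rw [← measure_iUnion]
    · rw [← Set.iUnion_inter, Set.inter_eq_right.2]
      intro z _
      refine Set.mem_iUnion.2 ⟨fun i => ⌊z i / s⌋, fun i _ => ?_⟩
      have hz := mul_div_cancel₀ (z i) hs.ne'
      have ha := mul_le_mul_of_nonneg_left (Int.floor_le (z i / s)) hs.le
      have hb := mul_lt_mul_of_pos_left (Int.lt_floor_add_one (z i / s)) hs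
      simp only [v, Pi.sub_apply, Set.mem_Ico]
      constructor <;> linarith
    · intro q q' hq
      refine Set.disjoint_left.2 fun z hz hz' => hq (funext fun i => ?_)
      have ha := hz.1 i trivial
      have hb := hz'.1 i trivial
      simp only [v, Pi.sub_apply, Set.mem_Ico] at ha hb
      have h4 : ((q i - q' i : ℤ) : ℝ) < 1 := by
        push_cast
        exact lt_of_mul_lt_mul_left (by linarith) hs.le
      have h5 : ((q' i - q i : ℤ) : ℝ) < 1 := by
        push_cast
        exact lt_of_mul_lt_mul_left (by linarith) hs.le
      have h4' : q i - q' i < 1 := by exact_mod_cast h4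
      have h5' : q' i - q i < 1 := by exact_mod_cast h5
      omega
    · exact fun q => (measurable_sub_const _ hB).inter (hA r)
  rw [← hvB, h1, ENNReal.tsum_prod', tsum_fintype]
  exact Finset.sum_congr rfl fun r _ => (h2 r).symm

lemma volume_hyperplane_eq_zero {n : ℕ} {w : Fin n → ℝ} (hw : w ≠ 0) (c : ℝ) :
    volume {y : Fin n → ℝ | ∑ i, w i * y i = c} = 0 := by
  obtain ⟨i, hi⟩ := Function.ne_iff.1 hw
  let f : (Fin n → ℝ) →ₗ[ℝ] ℝ := ∑ i, w i • LinearMap.proj i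
  have hf (y) : f y = ∑ i, w i * y i := by simp [f]
  let E : AffineSubspace ℝ (Fin n → ℝ) :=
    (AffineSubspace.mk' c ⊥).comap f.toAffineMap
  have hE (y) : y ∈ E ↔ ∑ i, w i * y i = c := by
    simp [E, AffineSubspace.mem_mk', hf, sub_eq_zero]
  have hset : {y : Fin n → ℝ | ∑ i, w i * y i = c} = E := by
    ext y; exact (hE y).symm
  rw [hset]
  refine Measure.addHaar_affineSubspace volume E fun htop => ?_
  have h0 := (hE 0).1 (htop ▸ AffineSubspace.mem_top ℝ _ _)
  have h1 := (hE (Pi.single i 1)).1 (htop ▸ AffineSubspace.mem_top ℝ _ _)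
  simp [Pi.single_apply] at h0 h1
  exact hi (by simp [h1, ← h0])

/-- The affine section of the projection forgetting the last coordinate, with coordinate sum `C`. -/
def extendSum (n : ℕ) (C : ℝ) (y : Fin n → ℝ) : Fin (n + 1) → ℝ :=
  Fin.snoc (α := fun _ => ℝ) y (C - ∑ i, y i)

lemma sum_extendSum (n : ℕ) (C : ℝ) (y : Fin n → ℝ) : ∑ i, extendSum n C y i = C := by
  simp [Fin.sum_univ_castSucc, extendSum]

lemma eq_extendSum {n : ℕ} {C : ℝ} {z : Fin (n + 1) → ℝ} (hz : ∑ i, z i = C) :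
    z = extendSum n C fun i => z i.castSucc := by
  rw [Fin.sum_univ_castSucc] at hz
  funext i
  refine Fin.lastCases ?_ (fun j => ?_) i
  · simp [extendSum, ← hz]
  · simp [extendSum]

lemma volume_extendSum_hyperplane {n : ℕ} (C c : ℝ) {S : Finset (Fin (n + 1))}
    (hS : S.Nonempty) (hSc : Sᶜ.Nonempty) :
    volume {y : Fin n → ℝ | ∑ i ∈ S, extendSum n C y i = c} = 0 := by
  let χ : Fin (n + 1) → ℝ := fun i => if i ∈ S then 1 else 0
  have hχ (y : Fin n → ℝ) : ∑ i ∈ S, extendSum n C y i =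
      ∑ i, (χ i.castSucc - χ (Fin.last n)) * y i + χ (Fin.last n) * C := by
    have h1 : ∑ i ∈ S, extendSum n C y i = ∑ i, χ i * extendSum n C y i := by
      simp [χ]
    rw [h1, Fin.sum_univ_castSucc]
    simp only [extendSum, Fin.snoc_castSucc, Fin.snoc_last, sub_mul, Finset.sum_sub_distrib,
      ← Finset.mul_sum]
    ring
  have hw : (fun i : Fin n => χ i.castSucc - χ (Fin.last n)) ≠ 0 := by
    intro h
    have hc (i : Fin (n + 1)) : χ i = χ (Fin.last n) := by
      refine Fin.lastCases rfl (fun j => ?_) i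
      exact sub_eq_zero.1 (congrFun h j)
    obtain ⟨i, hi⟩ := hS
    obtain ⟨j, hj⟩ := hSc
    have := (hc i).trans (hc j).symm
    simp [χ, hi, Finset.mem_compl.1 hj] at this
  refine measure_mono_null (fun y hy => ?_)
    (volume_hyperplane_eq_zero hw (c - χ (Fin.last n) * C))
  have := hχ y
  rw [Set.mem_ofPred_eq] at hy ⊢
  linarith

lemma extendSum_const_sub (n : ℕ) (C c : ℝ) (y : Fin n → ℝ) (i : Fin (n + 1)) :
    extendSum n ((n + 1) * c - C) (fun i => c - y i) i = c - extendSum n C y i := by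
  refine Fin.lastCases ?_ (fun j => ?_) i
  · simp only [extendSum, Fin.snoc_last, Finset.sum_sub_distrib, Finset.sum_const,
      Finset.card_univ, Fintype.card_fin, nsmul_eq_mul]
    ring
  · simp [extendSum]

lemma extendSum_add_lattice (n : ℕ) (C s : ℝ) (r : ℤ) (y : Fin n → ℝ) (a : Fin (n + 1) → ℤ)
    (ha : ∑ i, a i = r) (i : Fin (n + 1)) :
    extendSum n (C + s * r) (y + fun i => s * a i.castSucc) i = extendSum n C y i + s * a i := by
  rw [Fin.sum_univ_castSucc] at ha
  refine Fin.lastCases ?_ (fun j => ?_) i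
  · simp only [extendSum, Fin.snoc_last, ← ha, Pi.add_apply, Finset.sum_add_distrib,
      ← Finset.mul_sum]
    push_cast
    ring
  · simp [extendSum]

lemma sum_volume_permutohedra {n : ℕ} {U : ℤ → ℝ} {s : ℝ} (hU : Monotone U)
    (hper : ∀ m, U (m + (n + 1 : ℕ)) = U m + s) (hs : 0 < s) :
    ∑ r : Fin (n + 1), volume ((fun t : Fin (n + 1) → ℝ => fun i : Fin n => t i.castSucc) ''
      permutohedron (n + 1) (fun i => U (r + n) - U (r + (i : ℕ)))) = ENNReal.ofReal (s ^ n) := by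
  let D : Fin (n + 1) → Set (Fin n → ℝ) := fun r =>
    (fun t : Fin (n + 1) → ℝ => fun i : Fin n => t i.castSucc) ''
      permutohedron (n + 1) (fun i => U (r + n) - U (r + (i : ℕ)))
  let A : Fin (n + 1) → Set (Fin n → ℝ) := fun r => (fun y => (fun _ => U (r + n)) - y) ⁻¹' D r
  have hD (r) : MeasurableSet (D r) := by
    refine ((isCompact_permutohedron _).image ?_).measurableSet
    fun_prop
  have hvol (r) : volume (A r) = volume (D r) :=
    (Measure.measurePreserving_sub_left volume _).measure_preimage (hD r).nullMeasurableSet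
  let C := ∑ j ∈ Finset.range (n + 1), U j
  have hA (r : Fin (n + 1)) (y : Fin n → ℝ) : y ∈ A r ↔ ∀ S : Finset (Fin (n + 1)),
      ∑ j ∈ Finset.range S.card, U ((r : ℕ) + j) ≤
        ∑ i ∈ S, extendSum n (C + s * ((r : ℕ) : ℤ)) y i := by
    have hX : Antitone fun k : ℕ => U ((r : ℕ) + n) - U ((r : ℕ) + k) := fun i j hij => by
      have := hU (show ((r : ℕ) : ℤ) + i ≤ (r : ℕ) + j by omega)
      simp only
      linarith
    have hsum (k : ℕ) : ∑ j ∈ Finset.range k, (U ((r : ℕ) + n) - U ((r : ℕ) + j)) =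
        k * U ((r : ℕ) + n) - ∑ j ∈ Finset.range k, U ((r : ℕ) + j) := by
      simp [Finset.sum_sub_distrib]
    have htot := hsum (n + 1)
    rw [sum_period hper] at htot
    have hiff (z : Fin (n + 1) → ℝ) := mem_permutohedron_iff n hX z
    have hsec := extendSum_const_sub n (C + s * ((r : ℕ) : ℤ)) (U ((r : ℕ) + n)) y
    push_cast at htot
    constructor
    · rintro ⟨z, hz, hzy⟩ S
      obtain ⟨h1, h2⟩ := (hiff z).1 hz
      rw [htot] at h1
      have h3 := eq_extendSum h1
      have h4 (i) : z i = U ((r : ℕ) + n) - extendSum n (C + s * ((r : ℕ) : ℤ)) y i := by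
        rw [← hsec, congrFun h3 i]
        congr 1
      have h5 := h2 S
      rw [hsum, Finset.sum_congr rfl fun i _ => h4 i, Finset.sum_sub_distrib] at h5
      simp only [Finset.sum_const, nsmul_eq_mul] at h5
      linarith
    · intro h
      refine ⟨fun i => U ((r : ℕ) + n) - extendSum n (C + s * ((r : ℕ) : ℤ)) y i,
        (hiff _).2 ⟨?_, fun S => ?_⟩, ?_⟩
      · rw [htot, Finset.sum_sub_distrib, sum_extendSum]
        simp [C]
      · rw [hsum, Finset.sum_sub_distrib]
        simp only [Finset.sum_const, nsmul_eq_mul]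
        linarith [h S]
      · funext i
        simp [extendSum]
  have hA' (a : Fin (n + 1) → ℤ) (r : Fin (n + 1)) (har : ∑ i, a i = (r : ℕ)) (y : Fin n → ℝ) :
      (y + fun i => s * (a i.castSucc : ℝ)) ∈ A r ↔ ∀ S : Finset (Fin (n + 1)),
        ∑ j ∈ Finset.range S.card, U (∑ i, a i + j) ≤
          ∑ i ∈ S, (extendSum n C y i + s * a i) := by
    simp only [hA, extendSum_add_lattice n C s _ y a har, har]
  have hsnoc (r : Fin (n + 1)) (q : Fin n → ℤ) : ∃ a : Fin (n + 1) → ℤ,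
      ∑ i, a i = (r : ℕ) ∧ ∀ i : Fin n, a i.castSucc = q i :=
    ⟨Fin.snoc (α := fun _ => ℤ) q ((r : ℕ) - ∑ i, q i), by simp [Fin.sum_univ_castSucc], by simp⟩
  rw [← sum_volume_of_tiling hs A (fun r => (measurable_const.sub measurable_id) (hD r)) ?_ ?_]
  · exact Finset.sum_congr rfl fun r _ => (hvol r).symm
  · intro y
    obtain ⟨a, h0, h1, h⟩ := exists_tile n.succ_pos hper hs _ (sum_extendSum n C y)
    let r : Fin (n + 1) := ⟨(∑ i, a i).toNat, by omega⟩
    have har : ∑ i, a i = (r : ℕ) := by simp only [r]; omega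
    exact ⟨r, fun i => a i.castSucc, (hA' a r har y).2 h⟩
  · intro r r' q q' hne
    obtain ⟨a, har, haq⟩ := hsnoc r q
    obtain ⟨b, hbr, hbq⟩ := hsnoc r' q'
    have hab : a ≠ b := by
      rintro rfl
      refine hne (Prod.ext (Fin.ext ?_) (funext fun i => ?_))
      · exact_mod_cast har.symm.trans hbr
      · exact (haq i).symm.trans (hbq i)
    refine measure_mono_null (t := ⋃ S : {S : Finset (Fin (n + 1)) // S.Nonempty ∧ Sᶜ.Nonempty},
      {y : Fin n → ℝ | ∑ i ∈ S.1, extendSum n C y i =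
        ∑ j ∈ Finset.range S.1.card, U (∑ i, a i + j) - s * ∑ i ∈ S.1, (a i : ℝ)}) ?_
      (measure_iUnion_null fun S => volume_extendSum_hyperplane C _ S.2.1 S.2.2)
    rintro y ⟨hy, hy'⟩
    simp only [← haq] at hy
    simp only [← hbq] at hy'
    obtain ⟨S, hS, hSc, h⟩ := eq_of_mem_two_tiles hU hper _ (sum_extendSum n C y) a b
      (by omega) (by omega) (by omega) (by omega) hab
      ((hA' a r har y).1 hy) ((hA' b r' hbr y).1 hy')
    exact Set.mem_iUnion.2 ⟨⟨S, hS, hSc⟩, h⟩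

lemma Vhat_zero (n : ℕ) (hn : 1 ≤ n) : Vhat n (fun _ => 0) = 0 := by
  have : Nonempty (Fin n) := ⟨⟨0, hn⟩⟩
  simp [Vhat, projVol, permutohedron]

theorem stmt18 (n : ℕ) (hn : 1 ≤ n) (u : Fin (n + 1) → ℝ) (hu : ∀ i, 0 ≤ u i) :
    ∑ r : Fin (n + 1), Vhat n (fun i => u (i + r)) = (∑ i, u i) ^ n := by
  rcases (Finset.sum_nonneg fun i _ => hu i : 0 ≤ ∑ i, u i).eq_or_lt with hs | hs
  · have hzero : ∀ i, u i = 0 := fun i =>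
      (Finset.sum_eq_zero_iff_of_nonneg fun i _ => hu i).1 hs.symm i (Finset.mem_univ i)
    simp [hzero, Vhat_zero n hn, show n ≠ 0 by omega]
  let v : ℤ → ℝ := fun m => u ⟨(m % (n + 1 : ℕ)).toNat, by
    have := Int.emod_nonneg m (show ((n + 1 : ℕ) : ℤ) ≠ 0 by omega)
    have := Int.emod_lt_of_pos m (show (0 : ℤ) < (n + 1 : ℕ) by omega)
    omega⟩
  obtain ⟨U, -, hUv⟩ := exists_int_antidifference v
  have hmono : Monotone U := monotone_int_of_le_succ fun m => by
    rw [hUv]; exact le_add_of_nonneg_right (hu _)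
  have hvu (i r : Fin (n + 1)) : v ((r : ℕ) + (i : ℕ)) = u (i + r) := by
    simp only [v]
    congr 1
    ext
    rw [Fin.val_add, add_comm ((r : ℕ) : ℤ)]
    norm_cast
  have hper (m) : U (m + (n + 1 : ℕ)) = U m + ∑ i, u i := by
    have h := int_affine_of_step (D := fun m => U (m + (n + 1 : ℕ)) - U m) (s := 0) (fun m => by
      have hv : v (m + (n + 1 : ℕ)) = v m := by simp only [v, Int.add_emod_right]
      rw [add_right_comm, hUv, hUv, hv]
      ring) m
    have h0 := sum_range_of_step hUv 0 (n + 1)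
    rw [← Fin.sum_univ_eq_sum_range (fun j => v (0 + j))] at h0
    have h1 : ∑ i : Fin (n + 1), v (0 + (i : ℕ)) = ∑ i, u i :=
      Finset.sum_congr rfl fun i _ => by simpa using hvu i 0
    linarith
  have key := sum_volume_permutohedra hmono hper hs
  have hV (r : Fin (n + 1)) : Vhat n (fun i => u (i + r)) =
      (volume ((fun t : Fin (n + 1) → ℝ => fun i : Fin n => t i.castSucc) ''
        permutohedron (n + 1) (fun i => U (r + n) - U (r + (i : ℕ))))).toReal := by
    have hx (k : Fin (n + 1)) :
        (∑ j : Fin (n + 1), if (k : ℕ) ≤ (j : ℕ) ∧ (j : ℕ) < n then u (j + r) else 0) =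
          U (r + n) - U (r + (k : ℕ)) := by
      simp only [← hvu]
      rw [Fin.sum_univ_eq_sum_range
        (fun j => if (k : ℕ) ≤ j ∧ j < n then v ((r : ℕ) + j) else 0), ← Finset.sum_filter]
      have hf : (Finset.range (n + 1)).filter (fun j => (k : ℕ) ≤ j ∧ j < n) =
          Finset.Ico (k : ℕ) n := by
        ext j; simp; omega
      rw [hf, ← Finset.sum_Ico_sub (fun j : ℕ => U ((r : ℕ) + j)) (show (k : ℕ) ≤ n by omega)]
      refine Finset.sum_congr rfl fun j _ => ?_
      rw [Nat.cast_succ, ← add_assoc, hUv]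
      ring
    simp only [Vhat, projVol, hx]
  simp only [hV]
  rw [← ENNReal.toReal_sum, key, ENNReal.toReal_ofReal (by positivity)]
  intro r hr hr'
  exact (ENNReal.sum_lt_top.1 (key ▸ ENNReal.ofReal_lt_top) r hr).ne hr'
end
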